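/- arXiv:2409.11381 — 2 statements merged into one kernel-verified Lean document; each statement's English description precedes it below -/
import Mathlib

section
/- Under the correlated Gaussian model with parameter ε ≥ 1, let λ_n be a sequence with λ_n ≤ D√n for a fixed D > 0 and λ_n/n^{1/4} → ∞, and set Y_n = X_n + (λ_n/√n)·𝟙𝟙ᵀ. Assume in addition that Var((1/n)·Σ_{i,j=1}^n X_n(i,j)) → 2 as n → ∞ (which holds automatically when ε > 1). Then √n·(λ₁(n^{-1/2} Y_n) − λ_n − 1/λ_n) converges in distribution to a centered Gaussian with variance 2 (i.e. to √2·Z with Z standard normal). -/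
open MeasureTheory ProbabilityTheory Filter Topology

noncomputable section

/-- The largest eigenvalue of a real symmetric matrix, realised as the supremum of its set
of real eigenvalues. -/
def lam1 {n : ℕ} (A : Matrix (Fin n) (Fin n) ℝ) : ℝ :=
  sSup {t : ℝ | ∃ v : Fin n → ℝ, v ≠ 0 ∧ A.mulVec v = t • v}

/-- A finite family of real random variables is a centered (jointly) Gaussian vector:
every linear combination of the coordinates has a centered Gaussian law. -/
def IsCenteredGaussianVec {Ω : Type*} [MeasureSpace Ω] {ι : Type*} [Fintype ι]
    (X : ι → Ω → ℝ) : Prop :=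
  (∀ i, Measurable (X i)) ∧
    ∀ c : ι → ℝ, ∃ v : NNReal,
      Measure.map (fun ω => ∑ i, c i * X i ω) (volume : Measure Ω) = gaussianReal 0 v

/-- Covariance of two real random variables. -/
def pcov {Ω : Type*} [MeasureSpace Ω] (W V : Ω → ℝ) : ℝ :=
  (∫ ω, W ω * V ω) - (∫ ω, W ω) * ∫ ω, V ω

/-- Variance of a real random variable. -/
def pvar {Ω : Type*} [MeasureSpace Ω] (W : Ω → ℝ) : ℝ := pcov W W

/-- The correlated Gaussian model with parameter `ε` and constant `C`: for each `n`,
`X n` is a random symmetric `n × n` matrix whose entries `(X_{ij})_{i ≤ j}` form a centered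
Gaussian vector with unit variances and pairwise correlations bounded by `C * n ^ (-(1+ε))`. -/
structure CorrGaussian (Ω : Type*) [MeasureSpace Ω]
    (X : (n : ℕ) → Ω → Matrix (Fin n) (Fin n) ℝ) (C ε : ℝ) : Prop where
  symm : ∀ n ω, (X n ω).IsSymm
  gauss : ∀ n, IsCenteredGaussianVec fun p : Fin n × Fin n => fun ω => X n ω p.1 p.2
  var_one : ∀ n, ∀ i j : Fin n, ∫ ω, (X n ω i j) ^ 2 = 1
  corr_le : ∀ n, ∀ i j i' j' : Fin n, ¬((i, j) = (i', j') ∨ (i, j) = (j', i')) →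
    |∫ ω, X n ω i j * X n ω i' j'| ≤ C * (n : ℝ) ^ (-(1 + ε))

/-- The all-ones `n × n` matrix `𝟙𝟙ᵀ`. -/
def onesMat (n : ℕ) : Matrix (Fin n) (Fin n) ℝ := Matrix.of fun _ _ => 1

/-- The operator (spectral) norm of a real matrix, i.e. the norm of the induced map on
Euclidean space. -/
def opNorm {n : ℕ} (A : Matrix (Fin n) (Fin n) ℝ) : ℝ :=
  ‖(Matrix.toEuclideanLin A).toContinuousLinearMap‖

/-- `T n = O_P(a n)`: for every `δ > 0` there are `M > 0` and `n₀` such that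
`P(|T n| > M * a n) ≤ δ` for all `n ≥ n₀`. -/
def IsBigOP {Ω : Type*} [MeasureSpace Ω] (T : ℕ → Ω → ℝ) (a : ℕ → ℝ) : Prop :=
  ∀ δ : ℝ, 0 < δ → ∃ M : ℝ, 0 < M ∧ ∃ n₀ : ℕ, ∀ n ≥ n₀,
    (volume {ω | M * a n < |T n ω|}).toReal ≤ δ

/-- The sparse Rademacher(p) law `p δ_{-1} + (1 - 2p) δ_0 + p δ_1`. -/
def sparseRademacher (p : ℝ) : Measure ℝ :=
  ENNReal.ofReal p • Measure.dirac (-1) + ENNReal.ofReal (1 - 2 * p) • Measure.dirac 0 +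
    ENNReal.ofReal p • Measure.dirac 1

end

lemma lam1_spec {n : ℕ} (hn : 0 < n) (A : Matrix (Fin n) (Fin n) ℝ) (hA : A.IsSymm) :
    (∃ v : Fin n → ℝ, v ≠ 0 ∧ A.mulVec v = lam1 A • v) ∧
      (∀ v : Fin n → ℝ, v ⬝ᵥ A.mulVec v ≤ lam1 A * (v ⬝ᵥ v)) := by
  classical
  have : Nonempty (Fin n) := ⟨⟨0, hn⟩⟩
  set K : Set (Fin n → ℝ) := {v | v ⬝ᵥ v = 1} with hK
  have hcont : Continuous fun v : Fin n → ℝ => v ⬝ᵥ v := by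
    unfold dotProduct; fun_prop
  have hcontA : Continuous fun v : Fin n → ℝ => v ⬝ᵥ A.mulVec v := by
    unfold Matrix.mulVec dotProduct; fun_prop
  have hKc : IsCompact K := by
    apply Metric.isCompact_of_isClosed_isBounded
    · exact isClosed_singleton.preimage hcont
    · refine (Metric.isBounded_closedBall (x := (0 : Fin n → ℝ)) (r := 1)).subset ?_
      intro v hv
      rw [mem_closedBall_zero_iff, pi_norm_le_iff_of_nonneg zero_le_one]
      intro i
      have h1 : v i * v i ≤ v ⬝ᵥ v :=
        Finset.single_le_sum (f := fun i => v i * v i) (fun j _ => mul_self_nonneg (v j))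
          (Finset.mem_univ i)
      have h2 : v ⬝ᵥ v = 1 := hv
      rw [Real.norm_eq_abs, abs_le]
      constructor <;> nlinarith
  have hKn : K.Nonempty := by
    refine ⟨Pi.single ⟨0, hn⟩ 1, ?_⟩
    simp [hK]
  obtain ⟨v0, hv0, hmax⟩ := hKc.exists_isMaxOn hKn hcontA.continuousOn
  set m := v0 ⬝ᵥ A.mulVec v0 with hm
  have hv01 : v0 ⬝ᵥ v0 = 1 := hv0
  have hle : ∀ v : Fin n → ℝ, v ⬝ᵥ A.mulVec v ≤ m * (v ⬝ᵥ v) := by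
    intro v
    by_cases hv : v = 0
    · simp [hv]
    have hpos : 0 < v ⬝ᵥ v := by
      have h0 : 0 ≤ v ⬝ᵥ v := Finset.sum_nonneg fun i _ => mul_self_nonneg (v i)
      have h1 : v ⬝ᵥ v ≠ 0 := fun h => hv (dotProduct_self_eq_zero.mp h)
      exact lt_of_le_of_ne h0 h1.symm
    set c := (Real.sqrt (v ⬝ᵥ v))⁻¹ with hc
    have hcc : c * c * (v ⬝ᵥ v) = 1 := by
      have hs := Real.mul_self_sqrt hpos.le
      have hsp := Real.sqrt_pos.mpr hpos
      rw [hc]; field_simp; nlinarith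
    have hw : c • v ∈ K := by
      simp only [hK, Set.mem_ofPred_eq, smul_dotProduct, dotProduct_smul, smul_eq_mul]
      linarith
    have := hmax hw
    simp only [Set.mem_ofPred_eq, Matrix.mulVec_smul, smul_dotProduct, dotProduct_smul,
      smul_eq_mul] at this
    calc v ⬝ᵥ A.mulVec v = (c * (c * v ⬝ᵥ A.mulVec v)) * (v ⬝ᵥ v) := by
          linear_combination (-(v ⬝ᵥ A.mulVec v)) * hcc
      _ ≤ m * (v ⬝ᵥ v) := mul_le_mul_of_nonneg_right this hpos.le
  have hB : (m • (1 : Matrix (Fin n) (Fin n) ℝ) - A).PosSemidef := by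
    refine Matrix.PosSemidef.of_dotProduct_mulVec_nonneg ?_ ?_
    · rw [Matrix.IsHermitian]
      have : Matrix.transpose A = A := hA
      simp [Matrix.conjTranspose_eq_transpose_of_trivial, this]
    · intro x
      have := hle x
      simp only [star_trivial, Matrix.sub_mulVec, Matrix.smul_mulVec, Matrix.one_mulVec,
        dotProduct_sub, dotProduct_smul, smul_eq_mul]
      linarith
  have hev : A.mulVec v0 = m • v0 := by
    have := (hB.dotProduct_mulVec_zero_iff v0).mp (by
      simp only [star_trivial, Matrix.sub_mulVec, Matrix.smul_mulVec, Matrix.one_mulVec,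
        dotProduct_sub, dotProduct_smul, smul_eq_mul]
      rw [hv01]; linarith)
    simp only [Matrix.sub_mulVec, Matrix.smul_mulVec, Matrix.one_mulVec] at this
    exact (sub_eq_zero.mp this).symm
  have hv0ne : v0 ≠ 0 := by
    rintro rfl
    simp at hv01
  have hgr : IsGreatest {t : ℝ | ∃ v : Fin n → ℝ, v ≠ 0 ∧ A.mulVec v = t • v} m := by
    refine ⟨⟨v0, hv0ne, hev⟩, ?_⟩
    rintro t ⟨v, hv, hvt⟩
    have h1 := hle v
    rw [hvt, dotProduct_smul, smul_eq_mul] at h1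
    have hpos : 0 < v ⬝ᵥ v := by
      have h0 : 0 ≤ v ⬝ᵥ v := Finset.sum_nonneg fun i _ => mul_self_nonneg (v i)
      have h1 : v ⬝ᵥ v ≠ 0 := fun h => hv (dotProduct_self_eq_zero.mp h)
      exact lt_of_le_of_ne h0 h1.symm
    exact le_of_mul_le_mul_right h1 hpos
  have hl : lam1 A = m := hgr.csSup_eq
  rw [hl]
  exact ⟨⟨v0, hv0ne, hev⟩, hle⟩

lemma measurable_lam1 {Ω : Type*} [MeasurableSpace Ω] {n : ℕ}
    (A : Ω → Matrix (Fin n) (Fin n) ℝ) (hA : ∀ ω, (A ω).IsSymm)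
    (hm : ∀ i j, Measurable fun ω => A ω i j) : Measurable fun ω => lam1 (A ω) := by
  rcases Nat.eq_zero_or_pos n with rfl | hn
  · have : (fun ω => lam1 (A ω)) = fun _ => lam1 (0 : Matrix (Fin 0) (Fin 0) ℝ) := by
      funext ω
      congr 1
      exact Subsingleton.elim _ _
    rw [this]; exact measurable_const
  apply measurable_of_Iic
  intro t
  obtain ⟨s, hsc, hsd⟩ := TopologicalSpace.exists_countable_dense (Fin n → ℝ)
  have heq : (fun ω => lam1 (A ω)) ⁻¹' Set.Iic t =
      ⋂ v ∈ s, {ω | v ⬝ᵥ (A ω).mulVec v ≤ t * (v ⬝ᵥ v)} := by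
    ext ω
    simp only [Set.mem_preimage, Set.mem_Iic, Set.mem_iInter, Set.mem_ofPred_eq]
    obtain ⟨⟨w, hw, hwe⟩, hle⟩ := lam1_spec hn (A ω) (hA ω)
    constructor
    · intro h v _
      refine (hle v).trans (mul_le_mul_of_nonneg_right h ?_)
      exact Finset.sum_nonneg fun i _ => mul_self_nonneg (v i)
    · intro h
      have hcl : IsClosed {v : Fin n → ℝ | v ⬝ᵥ (A ω).mulVec v ≤ t * (v ⬝ᵥ v)} := by
        apply isClosed_le
        · unfold Matrix.mulVec dotProduct; fun_prop
        · unfold dotProduct; fun_prop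
      have hall : ∀ v : Fin n → ℝ, v ⬝ᵥ (A ω).mulVec v ≤ t * (v ⬝ᵥ v) := by
        intro v
        have : closure s ⊆ {v : Fin n → ℝ | v ⬝ᵥ (A ω).mulVec v ≤ t * (v ⬝ᵥ v)} :=
          closure_minimal (fun v hv => h v hv) hcl
        exact this (hsd v)
      have h1 := hall w
      rw [hwe, dotProduct_smul, smul_eq_mul] at h1
      have hpos : 0 < w ⬝ᵥ w := by
        have h0 : 0 ≤ w ⬝ᵥ w := Finset.sum_nonneg fun i _ => mul_self_nonneg (w i)
        have h1 : w ⬝ᵥ w ≠ 0 := fun h => hw (dotProduct_self_eq_zero.mp h)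
        exact lt_of_le_of_ne h0 h1.symm
      exact le_of_mul_le_mul_right h1 hpos
  rw [heq]
  refine MeasurableSet.biInter hsc fun v _ => ?_
  apply measurableSet_le
  · unfold Matrix.mulVec dotProduct
    refine Finset.measurable_sum _ fun i _ => ?_
    refine Measurable.const_mul ?_ _
    refine Finset.measurable_sum _ fun j _ => ?_
    exact (hm i j).mul_const _
  · exact measurable_const

lemma gauss_moments (v : NNReal) :
    (∫ x, x ∂(gaussianReal 0 v)) = 0 ∧ (∫ x, x ^ 2 ∂(gaussianReal 0 v)) = v ∧
    (∫ x, x ^ 4 ∂(gaussianReal 0 v)) = 3 * (v : ℝ) ^ 2 := by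
  have hd : ∀ p q : ℝ → ℝ, (∀ t, HasDerivAt p (q t) t) →
      deriv (fun t : ℝ => p t * Real.exp (v * t ^ 2 / 2)) =
        fun t => (q t + p t * (v * t)) * Real.exp (v * t ^ 2 / 2) := by
    intro p q hp
    ext t
    have h1 : HasDerivAt (fun t : ℝ => (v : ℝ) * t ^ 2 / 2) (v * t) t := by
      have := ((hasDerivAt_pow 2 t).const_mul (v : ℝ)).div_const 2
      exact this.congr_deriv (by push_cast; ring)
    have := (hp t).mul h1.exp
    rw [HasDerivAt.deriv (f := fun t : ℝ => p t * Real.exp (v * t ^ 2 / 2)) this]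
    ring
  have hmgf : mgf id (gaussianReal 0 v) = fun t : ℝ => (1 : ℝ) * Real.exp (v * t ^ 2 / 2) := by
    rw [mgf_id_gaussianReal]; funext t; simp
  have d1 := hd (fun _ => 1) (fun _ => 0) (fun t => hasDerivAt_const t 1)
  have d2 := hd (fun t => v * t) (fun _ => v) (fun t => by
    simpa using (hasDerivAt_id t).const_mul (v : ℝ))
  have d3 := hd (fun t => v + v ^ 2 * t ^ 2) (fun t => 2 * v ^ 2 * t) (fun t => by
    have := ((hasDerivAt_pow 2 t).const_mul ((v : ℝ) ^ 2)).const_add (v : ℝ)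
    exact this.congr_deriv (by push_cast; ring))
  have d4 := hd (fun t => 3 * v ^ 2 * t + v ^ 3 * t ^ 3) (fun t => 3 * v ^ 2 + 3 * v ^ 3 * t ^ 2)
    (fun t => by
    have := ((hasDerivAt_id t).const_mul (3 * (v : ℝ) ^ 2)).add
      ((hasDerivAt_pow 3 t).const_mul ((v : ℝ) ^ 3))
    exact this.congr_deriv (by push_cast; ring))
  have i2 : iteratedDeriv 2 (mgf id (gaussianReal 0 v)) =
      fun t : ℝ => ((v : ℝ) + v ^ 2 * t ^ 2) * Real.exp (v * t ^ 2 / 2) := by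
    rw [iteratedDeriv_succ, iteratedDeriv_one, hmgf, d1]
    simp only [zero_add, one_mul]
    rw [d2]; funext t; ring
  have i4 : iteratedDeriv 4 (mgf id (gaussianReal 0 v)) 0 = 3 * (v : ℝ) ^ 2 := by
    rw [iteratedDeriv_succ, iteratedDeriv_succ, i2, d3]
    have : (fun t : ℝ => (2 * (v : ℝ) ^ 2 * t + (v + v ^ 2 * t ^ 2) * (v * t)) *
        Real.exp (v * t ^ 2 / 2)) = fun t : ℝ => (3 * (v : ℝ) ^ 2 * t + v ^ 3 * t ^ 3) *
        Real.exp (v * t ^ 2 / 2) := by funext t; ring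
    rw [this, d4]; simp
  refine ⟨integral_id_gaussianReal, ?_, ?_⟩
  · have := iteratedDeriv_mgf_zero (X := id) (μ := gaussianReal 0 v) (by simp) 2
    rw [i2] at this
    simpa using this.symm
  · have := iteratedDeriv_mgf_zero (X := id) (μ := gaussianReal 0 v) (by simp) 4
    rw [i4] at this
    simpa using this.symm

lemma gauss_integrable_pow (v : NNReal) (k : ℕ) :
    Integrable (fun x : ℝ => x ^ k) (gaussianReal 0 v) := by
  have h := memLp_id_gaussianReal (μ := 0) (v := v) k
  rcases Nat.eq_zero_or_pos k with rfl | hk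
  · simp
  have := h.integrable_norm_pow (by omega)
  refine this.mono' (by fun_prop) ?_
  filter_upwards with x
  simp

section Wick
set_option linter.unusedSectionVars false
variable {Ω : Type*} [MeasureSpace Ω] {ι : Type*} [Fintype ι]

/-- linear form in the coordinates -/
def lin (X : ι → Ω → ℝ) (c : ι → ℝ) (ω : Ω) : ℝ := ∑ i, c i * X i ω

/-- covariance of linear forms -/
noncomputable def qf (X : ι → Ω → ℝ) (c d : ι → ℝ) : ℝ := ∫ ω, lin X c ω * lin X d ω

lemma lin_add (X : ι → Ω → ℝ) (c d : ι → ℝ) (ω : Ω) :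
    lin X (c + d) ω = lin X c ω + lin X d ω := by
  simp [lin, add_mul, Finset.sum_add_distrib]

lemma lin_sub (X : ι → Ω → ℝ) (c d : ι → ℝ) (ω : Ω) :
    lin X (c - d) ω = lin X c ω - lin X d ω := by
  simp [lin, sub_mul, Finset.sum_sub_distrib]

lemma lin_measurable {X : ι → Ω → ℝ} (hX : IsCenteredGaussianVec X) (c : ι → ℝ) :
    Measurable (lin X c) := by
  unfold lin
  exact Finset.measurable_sum _ fun i _ => (hX.1 i).const_mul _

lemma lin_moments {X : ι → Ω → ℝ} (hX : IsCenteredGaussianVec X) (c : ι → ℝ) :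
    (∀ k : ℕ, Integrable (fun ω => lin X c ω ^ k)) ∧ (∫ ω, lin X c ω) = 0 ∧
    (∫ ω, lin X c ω ^ 4) = 3 * (∫ ω, lin X c ω ^ 2) ^ 2 := by
  obtain ⟨v, hv⟩ := hX.2 c
  have hm := lin_measurable hX c
  have hv' : Measure.map (lin X c) volume = gaussianReal 0 v := hv
  have hi : ∀ k : ℕ, (∫ ω, lin X c ω ^ k) = ∫ x, x ^ k ∂(gaussianReal 0 v) := by
    intro k
    rw [← hv', integral_map hm.aemeasurable (by fun_prop)]
  obtain ⟨g1, g2, g4⟩ := gauss_moments v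
  refine ⟨fun k => ?_, ?_, ?_⟩
  · have := gauss_integrable_pow v k
    rw [← hv'] at this
    exact this.comp_measurable hm
  · have := hi 1
    simp only [pow_one] at this
    rw [this, g1]
  · rw [hi, hi, g2, g4]

lemma lin_mul_integrable {X : ι → Ω → ℝ} (hX : IsCenteredGaussianVec X) (c d : ι → ℝ) :
    Integrable (fun ω => lin X c ω * lin X d ω) := by
  have h1 := ((lin_moments hX (c + d)).1 2).const_mul (1 / 4)
  have h2 := ((lin_moments hX (c - d)).1 2).const_mul (1 / 4)
  refine (h1.sub h2).congr ?_
  filter_upwards with ω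
  simp only [Pi.sub_apply, lin_add, lin_sub]
  ring

lemma qf_comm (X : ι → Ω → ℝ) (c d : ι → ℝ) : qf X c d = qf X d c := by
  simp [qf, mul_comm]

lemma qf_self (X : ι → Ω → ℝ) (c : ι → ℝ) : (∫ ω, lin X c ω ^ 2) = qf X c c := by
  simp [qf, sq]

lemma qf_add_left {X : ι → Ω → ℝ} (hX : IsCenteredGaussianVec X) (c d e : ι → ℝ) :
    qf X (c + d) e = qf X c e + qf X d e := by
  unfold qf
  rw [← integral_add (lin_mul_integrable hX c e) (lin_mul_integrable hX d e)]
  simp only [lin_add, add_mul]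

lemma qf_sub_left {X : ι → Ω → ℝ} (hX : IsCenteredGaussianVec X) (c d e : ι → ℝ) :
    qf X (c - d) e = qf X c e - qf X d e := by
  unfold qf
  rw [← integral_sub (lin_mul_integrable hX c e) (lin_mul_integrable hX d e)]
  simp only [lin_sub, sub_mul]

lemma qf_add_right {X : ι → Ω → ℝ} (hX : IsCenteredGaussianVec X) (c d e : ι → ℝ) :
    qf X e (c + d) = qf X e c + qf X e d := by
  rw [qf_comm, qf_add_left hX, qf_comm, qf_comm X d]

lemma qf_sub_right {X : ι → Ω → ℝ} (hX : IsCenteredGaussianVec X) (c d e : ι → ℝ) :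
    qf X e (c - d) = qf X e c - qf X e d := by
  rw [qf_comm, qf_sub_left hX, qf_comm, qf_comm X d]

lemma integral_eight {f1 f2 f3 f4 f5 f6 f7 f8 : Ω → ℝ} (h1 : Integrable f1) (h2 : Integrable f2)
    (h3 : Integrable f3) (h4 : Integrable f4) (h5 : Integrable f5) (h6 : Integrable f6)
    (h7 : Integrable f7) (h8 : Integrable f8) :
    Integrable (fun ω => f1 ω - f2 ω - f3 ω + f4 ω - f5 ω + f6 ω + f7 ω - f8 ω) ∧
    (∫ ω, f1 ω - f2 ω - f3 ω + f4 ω - f5 ω + f6 ω + f7 ω - f8 ω) =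
      (∫ ω, f1 ω) - (∫ ω, f2 ω) - (∫ ω, f3 ω) + (∫ ω, f4 ω) - (∫ ω, f5 ω) + (∫ ω, f6 ω)
        + (∫ ω, f7 ω) - (∫ ω, f8 ω) := by
  have i1 : Integrable (fun ω => f1 ω - f2 ω) := h1.sub h2
  have i2 : Integrable (fun ω => f1 ω - f2 ω - f3 ω) := i1.sub h3
  have i3 : Integrable (fun ω => f1 ω - f2 ω - f3 ω + f4 ω) := i2.add h4
  have i4 : Integrable (fun ω => f1 ω - f2 ω - f3 ω + f4 ω - f5 ω) := i3.sub h5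
  have i5 : Integrable (fun ω => f1 ω - f2 ω - f3 ω + f4 ω - f5 ω + f6 ω) := i4.add h6
  have i6 : Integrable (fun ω => f1 ω - f2 ω - f3 ω + f4 ω - f5 ω + f6 ω + f7 ω) := i5.add h7
  refine ⟨i6.sub h8, ?_⟩
  rw [integral_sub i6 h8, integral_add i5 h7, integral_add i4 h6,
    integral_sub i3 h5, integral_add i2 h4, integral_sub i1 h3, integral_sub h1 h2]

lemma wick {X : ι → Ω → ℝ} (hX : IsCenteredGaussianVec X) (a b c d : ι → ℝ) :
    Integrable (fun ω => lin X a ω * lin X b ω * lin X c ω * lin X d ω) ∧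
    (∫ ω, lin X a ω * lin X b ω * lin X c ω * lin X d ω) =
      qf X a b * qf X c d + qf X a c * qf X b d + qf X a d * qf X b c := by
  have I : ∀ e : ι → ℝ, Integrable (fun ω => lin X e ω ^ 4) := fun e => (lin_moments hX e).1 4
  have V : ∀ e : ι → ℝ, (∫ ω, lin X e ω ^ 4) = 3 * qf X e e ^ 2 := fun e => by
    rw [(lin_moments hX e).2.2, qf_self]
  have hpol : (fun ω => lin X a ω * lin X b ω * lin X c ω * lin X d ω) = fun ω => (1 / 192) *
      (lin X (a + b + c + d) ω ^ 4 - lin X (a + b + c - d) ω ^ 4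
      - lin X (a + b - c + d) ω ^ 4 + lin X (a + b - c - d) ω ^ 4
      - lin X (a - b + c + d) ω ^ 4 + lin X (a - b + c - d) ω ^ 4
      + lin X (a - b - c + d) ω ^ 4 - lin X (a - b - c - d) ω ^ 4) := by
    funext ω
    simp only [lin_add, lin_sub]
    ring
  obtain ⟨h1, h2⟩ := integral_eight (I (a + b + c + d)) (I (a + b + c - d)) (I (a + b - c + d))
    (I (a + b - c - d)) (I (a - b + c + d)) (I (a - b + c - d)) (I (a - b - c + d))
    (I (a - b - c - d))
  rw [hpol]
  refine ⟨h1.const_mul _, ?_⟩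
  rw [integral_const_mul, h2]
  simp only [V, qf_add_left hX, qf_sub_left hX, qf_add_right hX, qf_sub_right hX]
  rw [qf_comm X b a, qf_comm X c a, qf_comm X d a, qf_comm X c b, qf_comm X d b, qf_comm X d c]
  ring

end Wick

lemma det_real (lam mu a b g r s : ℝ) (hs : 1 ≤ s) (hr : 1 ≤ r) (hlam : 1 ≤ lam)
    (hmu : 3 / 4 * lam ≤ mu) (hx : mu ^ 2 * (mu - lam) = lam * mu * a + lam * b + g)
    (ha : r * |a| ≤ s) (hb : r * |b - 1| ≤ s) (hg : |g| ≤ 3 * s ^ 2) :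
    r * |mu - lam - 1 / lam - a| ≤ 100 * s ^ 3 * (1 / lam + r / lam ^ 2) := by
  have hl0 : 0 < lam := by linarith
  have hm0 : 0 < mu := by linarith
  obtain ⟨q, hq⟩ : ∃ q, q = 1 / lam := ⟨_, rfl⟩
  obtain ⟨p, hp⟩ : ∃ p, p = 1 / mu := ⟨_, rfl⟩
  have hlq : lam * q = 1 := by rw [hq]; field_simp
  have hmp : mu * p = 1 := by rw [hp]; field_simp
  have hq0 : 0 < q := by rw [hq]; positivity
  have hp0 : 0 < p := by rw [hp]; positivity
  have hq1 : q ≤ 1 := by rw [hq, div_le_one hl0]; exact hlam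
  have hpq : p ≤ 4 / 3 * q := by
    rw [hp, hq, div_le_iff₀ hm0]
    calc (1 : ℝ) = 4 / 3 * (1 / lam) * (3 / 4 * lam) := by field_simp
      _ ≤ 4 / 3 * (1 / lam) * mu := mul_le_mul_of_nonneg_left hmu (by positivity)
  have hrl : r / lam ^ 2 = r * q ^ 2 := by rw [hq]; field_simp
  rw [hrl, ← hq]
  have hlp : lam * p ≤ 4 / 3 := by
    calc lam * p ≤ lam * (4 / 3 * q) := mul_le_mul_of_nonneg_left hpq hl0.le
      _ = 4 / 3 := by linear_combination (4 / 3) * hlq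
  have hlp0 : 0 ≤ lam * p := by positivity
  have ha1 : |a| ≤ s := le_trans (le_mul_of_one_le_left (abs_nonneg a) hr) ha
  have hb1 : |b - 1| ≤ s := le_trans (le_mul_of_one_le_left (abs_nonneg _) hr) hb
  have hb2 : |b| ≤ 2 * s := by
    have := abs_add_le (b - 1) 1
    simp only [sub_add_cancel, abs_one] at this
    linarith
  have hss : s ≤ s ^ 2 := by nlinarith
  have hs3 : s ^ 2 ≤ s ^ 3 := by nlinarith [sq_nonneg s]
  have hp2 : p ^ 2 ≤ 16 / 9 * q ^ 2 := by
    have := pow_le_pow_left₀ hp0.le hpq 2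
    linarith
  have hqq : q ^ 2 ≤ 1 := pow_le_one₀ hq0.le hq1
  obtain ⟨x, hxdef⟩ : ∃ x, x = mu - lam := ⟨_, rfl⟩
  rw [← hxdef] at hx ⊢
  have hxe : x = (lam * p) * a + (lam * p) * p * b + p ^ 2 * g := by
    have : x = (mu * p) ^ 2 * x := by rw [hmp]; ring
    rw [this]
    have h2 : (mu * p) ^ 2 * x = p ^ 2 * (mu ^ 2 * x) := by ring
    rw [h2, hx]
    linear_combination (lam * p * a) * hmp
  have hxb : |x| ≤ 11 * s ^ 2 := by
    rw [hxe]
    have h1 : |(lam * p) * a| ≤ 4 / 3 * s := by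
      rw [abs_mul, abs_of_nonneg hlp0]
      exact mul_le_mul hlp ha1 (abs_nonneg _) (by norm_num)
    have h2 : |(lam * p) * p * b| ≤ 16 / 9 * (2 * s) := by
      rw [abs_mul, abs_of_nonneg (by positivity)]
      refine mul_le_mul ?_ hb2 (abs_nonneg _) (by norm_num)
      have := mul_le_mul hlp (show p ≤ 4 / 3 by linarith) hp0.le (by norm_num)
      linarith
    have h3 : |p ^ 2 * g| ≤ 16 / 9 * (3 * s ^ 2) := by
      rw [abs_mul, abs_of_nonneg (by positivity)]
      refine mul_le_mul ?_ hg (abs_nonneg _) (by norm_num)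
      linarith
    have h4 := abs_add_le ((lam * p) * a + (lam * p) * p * b) (p ^ 2 * g)
    have h5 := abs_add_le ((lam * p) * a) ((lam * p) * p * b)
    linarith
  have hdec : x - q - a = -(a * x * p) - b * x * (p ^ 2 + q * p) + (b - 1) * q + g * p ^ 2 := by
    have e1 : lam * p - 1 = - x * p := by rw [hxdef]; linear_combination hmp
    have e2 : lam * p * p - q = - x * (p ^ 2 + q * p) := by
      rw [hxdef]; linear_combination (p + q) * hmp - p * hlq
    linear_combination hxe + a * e1 + b * e2
  rw [hdec]
  have t1 : r * |a * x * p| ≤ 15 * s ^ 3 * q := by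
    rw [abs_mul, abs_mul, abs_of_pos hp0]
    calc r * (|a| * |x| * p) = (r * |a|) * |x| * p := by ring
      _ ≤ s * (11 * s ^ 2) * (4 / 3 * q) := by gcongr
      _ ≤ 15 * s ^ 3 * q := by linarith [show 0 ≤ s ^ 3 * q by positivity]
  have t2 : r * |b * x * (p ^ 2 + q * p)| ≤ 71 * s ^ 3 * (r * q ^ 2) := by
    rw [abs_mul, abs_mul, abs_of_pos (show 0 < p ^ 2 + q * p by positivity)]
    have : p ^ 2 + q * p ≤ 28 / 9 * q ^ 2 := by
      have := mul_le_mul_of_nonneg_left hpq hq0.le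
      linarith
    calc r * (|b| * |x| * (p ^ 2 + q * p)) ≤ r * ((2 * s) * (11 * s ^ 2) * (28 / 9 * q ^ 2)) := by
          gcongr
      _ ≤ 71 * s ^ 3 * (r * q ^ 2) := by linarith [show 0 ≤ s ^ 3 * (r * q ^ 2) by positivity]
  have t3 : r * |(b - 1) * q| ≤ s ^ 3 * q := by
    rw [abs_mul, abs_of_pos hq0]
    calc r * (|b - 1| * q) = (r * |b - 1|) * q := by ring
      _ ≤ s ^ 3 * q := mul_le_mul_of_nonneg_right (by linarith) hq0.le
  have t4 : r * |g * p ^ 2| ≤ 6 * s ^ 3 * (r * q ^ 2) := by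
    rw [abs_mul, abs_of_pos (show 0 < p ^ 2 by positivity)]
    calc r * (|g| * p ^ 2) ≤ r * ((3 * s ^ 3) * (16 / 9 * q ^ 2)) := by
          gcongr; linarith
      _ ≤ 6 * s ^ 3 * (r * q ^ 2) := by linarith [show 0 ≤ s ^ 3 * (r * q ^ 2) by positivity]
  have u1 := abs_add_le (-(a * x * p) - b * x * (p ^ 2 + q * p) + (b - 1) * q) (g * p ^ 2)
  have u2 := abs_add_le (-(a * x * p) - b * x * (p ^ 2 + q * p)) ((b - 1) * q)
  have u3 := abs_sub (-(a * x * p)) (b * x * (p ^ 2 + q * p))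
  rw [abs_neg] at u3
  have u4 : |-(a * x * p) - b * x * (p ^ 2 + q * p) + (b - 1) * q + g * p ^ 2| ≤
      |a * x * p| + |b * x * (p ^ 2 + q * p)| + |(b - 1) * q| + |g * p ^ 2| := by linarith
  have u5 := mul_le_mul_of_nonneg_left u4 (show 0 ≤ r by linarith)
  have v1 : 0 ≤ s ^ 3 * q := by positivity
  have v2 : 0 ≤ s ^ 3 * (r * q ^ 2) := by positivity
  linarith

lemma det_inner {E : Type*} [NormedAddCommGroup E] [InnerProductSpace ℝ E] (T : E →ₗ[ℝ] E)
    (hT : T.IsSymmetric) (u v : E) (lam mu r s : ℝ) (hs : 1 ≤ s) (hr : 1 ≤ r)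
    (hsl : 4 * s ≤ lam) (hop : ∀ x, ‖T x‖ ≤ lam / 4 * ‖x‖)
    (ha : r * |inner ℝ u (T u)| ≤ s) (hb : r * |‖T u‖ ^ 2 - 1| ≤ s)
    (hd : ‖T (T u)‖ ^ 2 ≤ s ^ 2) (hu : inner ℝ u u = (1 : ℝ))
    (hv : v ≠ 0) (hev : T v + (lam * inner ℝ u v) • u = mu • v)
    (hmu : lam + inner ℝ u (T u) ≤ mu) :
    r * |mu - lam - 1 / lam - inner ℝ u (T u)| ≤ 100 * s ^ 3 * (1 / lam + r / lam ^ 2) := by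
  have hlam : 1 ≤ lam := by linarith
  have hvpos : 0 < ‖v‖ := norm_pos_iff.mpr hv
  set a : ℝ := inner ℝ u (T u) with hadef
  have ha1 : |a| ≤ s := le_trans (le_mul_of_one_le_left (abs_nonneg a) hr) ha
  have hmu' : 3 / 4 * lam ≤ mu := by linarith [neg_abs_le a]
  have hk : inner ℝ u v ≠ (0 : ℝ) := by
    intro h
    rw [h] at hev
    simp only [mul_zero, zero_smul, add_zero] at hev
    have h1 := hop v
    rw [hev, norm_smul, Real.norm_eq_abs, abs_of_pos (by linarith)] at h1
    nlinarith
  set k : ℝ := inner ℝ u v with hkdef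
  set w := k⁻¹ • v with hw
  have hwe : T w + lam • u = mu • w := by
    have h2 : k⁻¹ • (T v + (lam * k) • u) = k⁻¹ • (mu • v) := by rw [hev]
    rw [hw, map_smul, smul_comm mu, ← h2, smul_add, smul_smul]
    congr 2
    field_simp
  have huw : inner ℝ u w = (1 : ℝ) := by
    rw [hw, inner_smul_right, ← hkdef]; field_simp
  have hwe2 : T (T w) + lam • T u = mu • T w := by
    rw [← map_smul T lam, ← map_smul T mu, ← map_add, hwe]
  have hwe3 : T (T (T w)) + lam • T (T u) = mu • T (T w) := by
    rw [← map_smul T lam, ← map_smul T mu, ← map_add, hwe2]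
  have e1 : inner ℝ u (T w) + lam = mu := by
    have := congrArg (fun z => inner ℝ u z) hwe
    simp only [inner_add_right, inner_smul_right, huw, hu, mul_one] at this
    exact this
  have e2 : inner ℝ u (T (T w)) + lam * a = mu * inner ℝ u (T w) := by
    have := congrArg (fun z => inner ℝ u z) hwe2
    simp only [inner_add_right, inner_smul_right] at this
    exact this
  have hbb : inner ℝ u (T (T u)) = ‖T u‖ ^ 2 := by
    rw [← hT, real_inner_self_eq_norm_sq]
  have e3 : inner ℝ (T u) (T (T w)) + lam * ‖T u‖ ^ 2 = mu * inner ℝ u (T (T w)) := by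
    have := congrArg (fun z => inner ℝ u z) hwe3
    simp only [inner_add_right, inner_smul_right, hbb] at this
    rw [← this, hT]
  have hn : ‖T (T w)‖ ≤ 2 * ‖T (T u)‖ := by
    have h1 : mu * ‖T (T w)‖ ≤ lam / 4 * ‖T (T w)‖ + lam * ‖T (T u)‖ := by
      calc mu * ‖T (T w)‖ = ‖mu • T (T w)‖ := by
            rw [norm_smul, Real.norm_eq_abs, abs_of_pos (by linarith)]
        _ = ‖T (T (T w)) + lam • T (T u)‖ := by rw [hwe3]
        _ ≤ ‖T (T (T w))‖ + ‖lam • T (T u)‖ := norm_add_le _ _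
        _ ≤ _ := by
            rw [norm_smul lam, Real.norm_eq_abs, abs_of_pos (show 0 < lam by linarith)]
            linarith [hop (T (T w))]
    have h2 : 3 / 4 * lam * ‖T (T w)‖ ≤ mu * ‖T (T w)‖ :=
      mul_le_mul_of_nonneg_right hmu' (norm_nonneg _)
    have h3 : lam * ‖T (T w)‖ ≤ lam * (2 * ‖T (T u)‖) := by linarith
    exact le_of_mul_le_mul_left h3 (by linarith)
  have hb1 : |‖T u‖ ^ 2 - 1| ≤ s := le_trans (le_mul_of_one_le_left (abs_nonneg _) hr) hb
  have hg : |inner ℝ (T u) (T (T w))| ≤ 3 * s ^ 2 := by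
    refine (abs_real_inner_le_norm _ _).trans ?_
    have h1 : ‖T u‖ ^ 2 ≤ 2 * s ^ 2 := by nlinarith [le_abs_self (‖T u‖ ^ 2 - 1)]
    have h2 : ‖T (T w)‖ ^ 2 ≤ 4 * s ^ 2 := by
      calc ‖T (T w)‖ ^ 2 ≤ (2 * ‖T (T u)‖) ^ 2 := by gcongr
        _ ≤ 4 * s ^ 2 := by rw [mul_pow]; linarith
    nlinarith [sq_nonneg (‖T u‖ - ‖T (T w)‖)]
  refine det_real lam mu a (‖T u‖ ^ 2) (inner ℝ (T u) (T (T w))) r s hs hr hlam hmu' ?_ ha hb hg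
  have e1' : inner ℝ u (T w) = mu - lam := by linarith
  rw [e1'] at e2
  linear_combination (-mu) * e2 - e3

/-- Deterministic perturbation bound, matrix form. -/
lemma det_matrix {n : ℕ} (hn : 0 < n) (W : Matrix (Fin n) (Fin n) ℝ) (hW : W.IsSymm)
    (u : Fin n → ℝ) (hu : u ⬝ᵥ u = 1) (lam r s : ℝ) (hs : 1 ≤ s) (hr : 1 ≤ r)
    (hsl : 4 * s ≤ lam) (hF : 16 ^ 2 * ∑ i, ∑ j, ((W * W) i j) ^ 2 ≤ lam ^ 4)
    (ha : r * |u ⬝ᵥ W.mulVec u| ≤ s)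
    (hb : r * |W.mulVec u ⬝ᵥ W.mulVec u - 1| ≤ s)
    (hd : W.mulVec (W.mulVec u) ⬝ᵥ W.mulVec (W.mulVec u) ≤ s ^ 2) :
    r * |lam1 (W + lam • Matrix.vecMulVec u u) - lam - 1 / lam - u ⬝ᵥ W.mulVec u| ≤
      100 * s ^ 3 * (1 / lam + r / lam ^ 2) := by
  classical
  set A := W + lam • Matrix.vecMulVec u u with hA
  have hAs : A.IsSymm := by
    have h1 : Matrix.transpose W = W := hW
    rw [Matrix.IsSymm, hA, Matrix.transpose_add, Matrix.transpose_smul, h1,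
      Matrix.transpose_vecMulVec]
  obtain ⟨⟨v, hv, hve⟩, hle⟩ := lam1_spec hn A hAs
  have hAv : ∀ x, A.mulVec x = W.mulVec x + (lam * (u ⬝ᵥ x)) • u := by
    intro x
    rw [hA, Matrix.add_mulVec, Matrix.smul_mulVec, Matrix.vecMulVec_mulVec]
    ext i
    simp [mul_comm]
    ring
  have hin : ∀ x y : Fin n → ℝ, inner ℝ (WithLp.toLp 2 x) (WithLp.toLp 2 y) = x ⬝ᵥ y := by
    intro x y
    rw [EuclideanSpace.inner_toLp_toLp, star_trivial, dotProduct_comm]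
  have hT : ∀ x : Fin n → ℝ, Matrix.toEuclideanLin W (WithLp.toLp 2 x) =
      WithLp.toLp 2 (W.mulVec x) := fun x => Matrix.toLpLin_toLp _ _ _ _
  have hnm : ∀ x : Fin n → ℝ, ‖(WithLp.toLp 2 x : EuclideanSpace ℝ (Fin n))‖ ^ 2 = x ⬝ᵥ x := by
    intro x
    rw [← real_inner_self_eq_norm_sq, hin]
  have hsym : (Matrix.toEuclideanLin W).IsSymmetric := by
    rw [Matrix.isSymmetric_toEuclideanLin_iff, Matrix.IsHermitian,
      Matrix.conjTranspose_eq_transpose_of_trivial]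
    exact hW
  have hl0 : 0 ≤ lam := by linarith
  have hop : ∀ x : EuclideanSpace ℝ (Fin n),
      ‖Matrix.toEuclideanLin W x‖ ≤ lam / 4 * ‖x‖ := by
    intro x
    have hx0 := norm_nonneg x
    have h1 : ‖Matrix.toEuclideanLin W x‖ ^ 2 ≤
        ‖x‖ * ‖Matrix.toEuclideanLin W (Matrix.toEuclideanLin W x)‖ := by
      rw [← real_inner_self_eq_norm_sq, hsym]
      exact real_inner_le_norm _ _
    have h2 : ‖Matrix.toEuclideanLin W (Matrix.toEuclideanLin W x)‖ ≤ lam ^ 2 / 16 * ‖x‖ := by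
      have hxx : x = WithLp.toLp 2 (WithLp.ofLp x) := rfl
      set y := WithLp.ofLp x with hy
      rw [hxx, hT, hT]
      refine (sq_le_sq₀ (norm_nonneg _) (by positivity)).mp ?_
      rw [mul_pow, hnm, hnm, Matrix.mulVec_mulVec]
      calc ((W * W).mulVec y) ⬝ᵥ ((W * W).mulVec y)
          = ∑ i, (∑ j, (W * W) i j * y j) ^ 2 := by
            simp [dotProduct, Matrix.mulVec, sq]
        _ ≤ ∑ i, (∑ j, ((W * W) i j) ^ 2) * (∑ j, y j ^ 2) :=
            Finset.sum_le_sum fun i _ => Finset.sum_mul_sq_le_sq_mul_sq _ _ _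
        _ = (∑ i, ∑ j, ((W * W) i j) ^ 2) * (y ⬝ᵥ y) := by
            rw [Finset.sum_mul]; simp [dotProduct, sq]
        _ ≤ (lam ^ 2 / 16) ^ 2 * (y ⬝ᵥ y) := by
            refine mul_le_mul_of_nonneg_right ?_ ?_
            · rw [div_pow]; linarith
            · exact Finset.sum_nonneg fun i _ => mul_self_nonneg (y i)
    refine (sq_le_sq₀ (norm_nonneg _) (by positivity)).mp ?_
    calc _ ≤ _ := h1
      _ ≤ ‖x‖ * (lam ^ 2 / 16 * ‖x‖) := mul_le_mul_of_nonneg_left h2 hx0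
      _ = _ := by ring
  have key := det_inner (Matrix.toEuclideanLin W) hsym (WithLp.toLp 2 u) (WithLp.toLp 2 v) lam
    (lam1 A) r s hs hr hsl hop (by rw [hT, hin]; exact ha) (by rw [hT, hnm]; exact hb)
    (by rw [hT, hT, hnm]; exact hd) (by rw [hin, hu])
    (by intro h; apply hv; simpa using h)
    (by
      rw [hT, hin, ← WithLp.toLp_smul, ← WithLp.toLp_add, ← WithLp.toLp_smul, ← hve, hAv])
    (by
      rw [hT, hin]
      have := hle u
      rw [hAv, dotProduct_add, dotProduct_smul, hu] at this
      simp only [smul_eq_mul, mul_one] at this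
      linarith)
  rwa [hT, hin] at key

section Moments
set_option linter.unusedSectionVars false
variable {Ω : Type*} [MeasureSpace Ω]

lemma sum_int {κ : Type*} [Fintype κ] {F : κ → Ω → ℝ} {g : κ → ℝ}
    (h : ∀ i, Integrable (F i) ∧ (∫ ω, F i ω) ≤ g i) :
    Integrable (fun ω => ∑ i, F i ω) ∧ (∫ ω, ∑ i, F i ω) ≤ ∑ i, g i := by
  refine ⟨integrable_finset_sum _ fun i _ => (h i).1, ?_⟩
  rw [integral_finset_sum _ fun i _ => (h i).1]
  exact Finset.sum_le_sum fun i _ => (h i).2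

/-- Kronecker delta -/
def dl {n : ℕ} (a b : Fin n) : ℝ := if a = b then 1 else 0

lemma dl_nonneg {n : ℕ} (a b : Fin n) : 0 ≤ dl a b := by unfold dl; split_ifs <;> norm_num
lemma dl_le_one {n : ℕ} (a b : Fin n) : dl a b ≤ 1 := by unfold dl; split_ifs <;> norm_num
lemma dl_sq {n : ℕ} (a b : Fin n) : dl a b * dl a b = dl a b := by unfold dl; split_ifs <;> norm_num
lemma dl_sum {n : ℕ} (a : Fin n) : ∑ b, dl a b = 1 := by simp [dl]
lemma dl_sum' {n : ℕ} (a : Fin n) : ∑ b, dl b a = 1 := by simp [dl]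
lemma dl_self {n : ℕ} (a : Fin n) : dl a a = 1 := by simp [dl]
lemma dl_ne {n : ℕ} {a b : Fin n} (h : a ≠ b) : dl a b = 0 := by simp [dl, h]

/-- coordinate process of a matrix -/
def Xv {n : ℕ} (X : Ω → Matrix (Fin n) (Fin n) ℝ) : Fin n × Fin n → Ω → ℝ :=
  fun p ω => X ω p.1 p.2

/-- coefficient vector of an entry -/
def ee {n : ℕ} (a b : Fin n) : Fin n × Fin n → ℝ := fun p => if p = (a, b) then 1 else 0

/-- coefficient vector of a row sum -/
def rr {n : ℕ} (d : Fin n) : Fin n × Fin n → ℝ := fun p => if p.1 = d then 1 else 0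

lemma lin_ee {n : ℕ} (X : Ω → Matrix (Fin n) (Fin n) ℝ) (a b : Fin n) (ω : Ω) :
    lin (Xv X) (ee a b) ω = X ω a b := by
  simp [lin, ee, Xv]

lemma lin_rr {n : ℕ} (X : Ω → Matrix (Fin n) (Fin n) ℝ) (d : Fin n) (ω : Ω) :
    lin (Xv X) (rr d) ω = ∑ j, X ω d j := by
  simp only [lin, rr, Xv, Fintype.sum_prod_type]
  simp

/-- fixed-`n` hypotheses -/
structure Hyp {n : ℕ} (X : Ω → Matrix (Fin n) (Fin n) ℝ) (C η : ℝ) : Prop where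
  npos : 0 < n
  symm : ∀ ω, (X ω).IsSymm
  gauss : IsCenteredGaussianVec (Xv X)
  var_one : ∀ i j : Fin n, ∫ ω, (X ω i j) ^ 2 = 1
  corr_le : ∀ i j i' j' : Fin n, ¬((i, j) = (i', j') ∨ (i, j) = (j', i')) →
    |∫ ω, X ω i j * X ω i' j'| ≤ η
  eta_nonneg : 0 ≤ η
  eta_le : (n : ℝ) ^ 2 * η ≤ C

namespace Hyp
variable {n : ℕ} {X : Ω → Matrix (Fin n) (Fin n) ℝ} {C η : ℝ}

lemma n_ge (h : Hyp X C η) : (1 : ℝ) ≤ n := by exact_mod_cast h.npos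

lemma n_eta (h : Hyp X C η) : (n : ℝ) * η ≤ C := by
  have h1 := h.n_ge
  have h2 := h.eta_nonneg
  have h3 := h.eta_le
  nlinarith [mul_nonneg (mul_nonneg (sub_nonneg.mpr h1) (by linarith : (0:ℝ) ≤ n)) h2]

lemma eta_le' (h : Hyp X C η) : η ≤ C := by
  have h1 := h.n_ge
  have h2 := h.eta_nonneg
  have h3 := h.n_eta
  nlinarith

lemma C_nonneg (h : Hyp X C η) : 0 ≤ C := h.eta_nonneg.trans h.eta_le'

lemma K_eq (h : Hyp X C η) (a b c d : Fin n) :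
    qf (Xv X) (ee a b) (ee c d) = ∫ ω, X ω a b * X ω c d := by
  simp [qf, lin_ee]

lemma K_swap (h : Hyp X C η) (a b c d : Fin n) :
    qf (Xv X) (ee a b) (ee c d) = qf (Xv X) (ee b a) (ee c d) := by
  rw [h.K_eq, h.K_eq]
  congr 1; funext ω
  rw [(h.symm ω).apply]

lemma K_swap' (h : Hyp X C η) (a b c d : Fin n) :
    qf (Xv X) (ee a b) (ee c d) = qf (Xv X) (ee a b) (ee d c) := by
  rw [qf_comm, h.K_swap, qf_comm]

lemma K_self (h : Hyp X C η) (a b : Fin n) : qf (Xv X) (ee a b) (ee a b) = 1 := by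
  rw [h.K_eq, ← h.var_one a b]
  congr 1; funext ω; ring

lemma K_le (h : Hyp X C η) (a b c d : Fin n) :
    |qf (Xv X) (ee a b) (ee c d)| ≤ dl a c * dl b d + dl a d * dl b c + η := by
  have n1 := mul_nonneg (dl_nonneg a c) (dl_nonneg b d)
  have n2 := mul_nonneg (dl_nonneg a d) (dl_nonneg b c)
  by_cases h1 : a = c ∧ b = d
  · obtain ⟨rfl, rfl⟩ := h1
    rw [h.K_self, dl_self, dl_self]
    have := h.eta_nonneg
    simp only [abs_one]
    linarith
  by_cases h2 : a = d ∧ b = c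
  · obtain ⟨rfl, rfl⟩ := h2
    rw [h.K_swap', h.K_self, dl_self, dl_self]
    have := h.eta_nonneg
    simp only [abs_one]
    linarith
  rw [h.K_eq]
  have := h.corr_le a b c d (by simp only [Prod.mk.injEq]; tauto)
  linarith

lemma K_le_one (h : Hyp X C η) (a b c d : Fin n) :
    |qf (Xv X) (ee a b) (ee c d)| ≤ 1 + C := by
  by_cases h1 : a = c ∧ b = d
  · obtain ⟨rfl, rfl⟩ := h1
    rw [h.K_self]
    have := h.C_nonneg
    simp only [abs_one]
    linarith
  by_cases h2 : a = d ∧ b = c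
  · obtain ⟨rfl, rfl⟩ := h2
    rw [h.K_swap', h.K_self]
    have := h.C_nonneg
    simp only [abs_one]
    linarith
  rw [h.K_eq]
  have := h.corr_le a b c d (by simp only [Prod.mk.injEq]; tauto)
  linarith [h.eta_le']

lemma K_row (h : Hyp X C η) (a c d : Fin n) :
    |qf (Xv X) (ee a c) (ee a d)| ≤ dl c d + η := by
  by_cases h1 : c = d
  · subst h1
    rw [h.K_self, dl_self]
    have := h.eta_nonneg
    simp only [abs_one]
    linarith
  rw [h.K_eq, dl_ne h1]
  have := h.corr_le a c a d (by
    simp only [Prod.mk.injEq]; rintro (⟨_, h3⟩ | ⟨h2, h3⟩)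
    · exact h1 h3
    · exact h1 (h3.trans h2))
  linarith

lemma rr_right (h : Hyp X C η) (c : Fin n × Fin n → ℝ) (d : Fin n) :
    qf (Xv X) c (rr d) = ∑ j, qf (Xv X) c (ee d j) := by
  unfold qf
  rw [← integral_finset_sum _ fun j _ => lin_mul_integrable h.gauss c (ee d j)]
  simp only [lin_rr, lin_ee, Finset.mul_sum]

lemma rr_rr (h : Hyp X C η) (b d : Fin n) :
    qf (Xv X) (rr b) (rr d) = ∑ j, ∑ k, qf (Xv X) (ee d j) (ee b k) := by
  rw [h.rr_right]
  refine Finset.sum_congr rfl fun j _ => ?_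
  rw [qf_comm, h.rr_right]

lemma er_le (h : Hyp X C η) (a b d : Fin n) : |qf (Xv X) (ee a b) (rr d)| ≤ 2 + C := by
  rw [h.rr_right]
  refine (Finset.abs_sum_le_sum_abs _ _).trans ?_
  refine (Finset.sum_le_sum fun j _ => h.K_le a b d j).trans ?_
  simp only [Finset.sum_add_distrib, ← Finset.mul_sum, ← Finset.sum_mul, dl_sum, Finset.sum_const,
    Finset.card_univ, Fintype.card_fin, nsmul_eq_mul]
  have := dl_le_one a d
  have := dl_le_one b d
  have := h.n_eta
  linarith

lemma rr_diag (h : Hyp X C η) (b : Fin n) : |qf (Xv X) (rr b) (rr b) - n| ≤ C := by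
  rw [h.rr_rr]
  have e : (n : ℝ) = ∑ j : Fin n, ∑ k : Fin n, dl j k := by simp [dl_sum]
  have : (∑ j, ∑ k, qf (Xv X) (ee b j) (ee b k)) - (n : ℝ) =
      ∑ j, ∑ k, (qf (Xv X) (ee b j) (ee b k) - dl j k) := by
    simp only [Finset.sum_sub_distrib]
    rw [← e]
  rw [this]
  refine (Finset.abs_sum_le_sum_abs _ _).trans ?_
  have hb : ∀ j : Fin n, |∑ k, (qf (Xv X) (ee b j) (ee b k) - dl j k)| ≤ ∑ _k : Fin n, η := by
    intro j
    refine (Finset.abs_sum_le_sum_abs _ _).trans (Finset.sum_le_sum fun k _ => ?_)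
    by_cases hjk : j = k
    · subst hjk
      rw [h.K_self, dl_self]; simpa using h.eta_nonneg
    · have := h.K_row b j k
      rw [dl_ne hjk] at this ⊢
      simpa using this
  refine (Finset.sum_le_sum fun j _ => hb j).trans ?_
  have := h.eta_le
  simp only [Finset.sum_const, Finset.card_univ, Fintype.card_fin, nsmul_eq_mul]
  linarith

lemma rr_le (h : Hyp X C η) (b d : Fin n) :
    |qf (Xv X) (rr b) (rr d)| ≤ dl b d * n + (1 + C) := by
  by_cases hbd : b = d
  · subst hbd
    rw [dl_self]
    have := h.rr_diag b
    rw [abs_le] at this ⊢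
    have := h.n_ge
    have := h.C_nonneg
    constructor <;> linarith
  rw [h.rr_rr]
  refine (Finset.abs_sum_le_sum_abs _ _).trans ?_
  have hb : ∀ j : Fin n, |∑ k, qf (Xv X) (ee d j) (ee b k)| ≤ dl j b + n * η := by
    intro j
    refine (Finset.abs_sum_le_sum_abs _ _).trans ?_
    refine (Finset.sum_le_sum fun k _ => h.K_le d j b k).trans ?_
    simp only [Finset.sum_add_distrib, ← Finset.mul_sum, ← Finset.sum_mul, dl_sum,
      Finset.sum_const, Finset.card_univ, Fintype.card_fin, nsmul_eq_mul, dl_ne (Ne.symm hbd)]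
    linarith
  refine (Finset.sum_le_sum fun j _ => hb j).trans ?_
  have := h.eta_le
  simp only [Finset.sum_add_distrib, dl_sum', Finset.sum_const, Finset.card_univ,
    Fintype.card_fin, nsmul_eq_mul, dl_ne hbd]
  linarith

lemma m1 (h : Hyp X C η) :
    Integrable (fun ω => ∑ a, ∑ b, ((X ω * X ω) a b) ^ 2) ∧
    (∫ ω, ∑ a, ∑ b, ((X ω * X ω) a b) ^ 2) ≤ (4 + 9 * C + 3 * C ^ 2) * (n : ℝ) ^ 3 := by
  have hC := h.C_nonneg
  have hη := h.eta_nonneg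
  have hη' := h.eta_le'
  have hn := h.n_ge
  have key := sum_int fun a : Fin n => sum_int fun b : Fin n => sum_int fun c : Fin n =>
    sum_int (F := fun d ω => lin (Xv X) (ee a c) ω * lin (Xv X) (ee c b) ω *
      lin (Xv X) (ee a d) ω * lin (Xv X) (ee d b) ω)
      (g := fun d : Fin n => (1 + 2 * C) * (2 * dl a b + dl c d + dl a d) + (1 + 3 * C) * η)
      (fun d => by
        obtain ⟨w1, w2⟩ := wick h.gauss (ee a c) (ee c b) (ee a d) (ee d b)
        refine ⟨w1, ?_⟩
        rw [w2]
        have p1 : |qf (Xv X) (ee a c) (ee c b)| ≤ dl a b + η := by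
          rw [h.K_swap]; exact h.K_row _ _ _
        have p2 : |qf (Xv X) (ee a d) (ee d b)| ≤ dl a b + η := by
          rw [h.K_swap]; exact h.K_row _ _ _
        have p3 := h.K_row a c d
        have p4 : |qf (Xv X) (ee c b) (ee d b)| ≤ dl c d + η := by
          rw [h.K_swap, h.K_swap']; exact h.K_row _ _ _
        have p5 := h.K_le a c d b
        have p6 := h.K_le_one c b a d
        have s1 := mul_le_mul p1 p2 (abs_nonneg _) (by linarith [dl_nonneg a b])
        have s2 := mul_le_mul p3 p4 (abs_nonneg _) (by linarith [dl_nonneg c d])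
        have s3 := mul_le_mul p5 p6 (abs_nonneg _) (by
          have := mul_nonneg (dl_nonneg a d) (dl_nonneg c b)
          have := mul_nonneg (dl_nonneg a b) (dl_nonneg c d)
          linarith)
        rw [← abs_mul] at s1 s2 s3
        have t1 := le_trans (le_abs_self _) s1
        have t2 := le_trans (le_abs_self _) s2
        have t3 := le_trans (le_abs_self _) s3
        have q1 := dl_sq a b
        have q2 := dl_sq c d
        have d1 := dl_nonneg a b
        have d2 := dl_nonneg c d
        have d3 := dl_nonneg a d
        have k1 : (dl a b + η) * (dl a b + η) ≤ (1 + 2 * C) * dl a b + C * η := by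
          have : (dl a b + η) * (dl a b + η) = dl a b * dl a b + 2 * (η * dl a b) + η * η := by ring
          rw [this, q1]
          have := mul_le_mul_of_nonneg_right hη' d1
          have := mul_le_mul_of_nonneg_right hη' hη
          linarith
        have k2 : (dl c d + η) * (dl c d + η) ≤ (1 + 2 * C) * dl c d + C * η := by
          have : (dl c d + η) * (dl c d + η) = dl c d * dl c d + 2 * (η * dl c d) + η * η := by ring
          rw [this, q2]
          have := mul_le_mul_of_nonneg_right hη' d2
          have := mul_le_mul_of_nonneg_right hη' hη
          linarith
        have k3 : (dl a d * dl c b + dl a b * dl c d + η) * (1 + C) ≤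
            (1 + 2 * C) * (dl a d + dl a b) + (1 + C) * η := by
          have e1 := mul_le_of_le_one_right d3 (dl_le_one c b)
          have e2 := mul_le_of_le_one_right d1 (dl_le_one c d)
          have e3 : (dl a d * dl c b + dl a b * dl c d + η) * (1 + C) ≤
            (dl a d + dl a b + η) * (1 + C) := mul_le_mul_of_nonneg_right (by linarith) (by linarith)
          have e4 := mul_nonneg hC d3
          have e5 := mul_nonneg hC d1
          linarith
        linarith)
  have hfun : (fun ω => ∑ a, ∑ b, ((X ω * X ω) a b) ^ 2) = fun ω => ∑ a, ∑ b, ∑ c, ∑ d,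
      lin (Xv X) (ee a c) ω * lin (Xv X) (ee c b) ω *
      lin (Xv X) (ee a d) ω * lin (Xv X) (ee d b) ω := by
    funext ω
    refine Finset.sum_congr rfl fun a _ => Finset.sum_congr rfl fun b _ => ?_
    simp only [lin_ee, Matrix.mul_apply]
    rw [sq, Finset.sum_mul_sum]
    refine Finset.sum_congr rfl fun c _ => Finset.sum_congr rfl fun d _ => ?_
    ring
  rw [hfun]
  refine ⟨key.1, key.2.trans ?_⟩
  simp only [Finset.sum_add_distrib, ← Finset.mul_sum, dl_sum, Finset.sum_const, Finset.card_univ,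
    Fintype.card_fin, nsmul_eq_mul]
  have e1 : (n : ℝ) ^ 2 * ((n : ℝ) ^ 2 * η) ≤ (n : ℝ) ^ 2 * C :=
    mul_le_mul_of_nonneg_left h.eta_le (by positivity)
  have e2 : (n : ℝ) ^ 2 * C ≤ (n : ℝ) ^ 3 * C :=
    mul_le_mul_of_nonneg_right (pow_le_pow_right₀ hn (by norm_num)) hC
  have e3 := mul_le_mul_of_nonneg_left (e1.trans e2) (show 0 ≤ 1 + 3 * C by linarith)
  linarith

lemma m2 (h : Hyp X C η) :
    Integrable (fun ω => ∑ a, (∑ b, X ω a b * ∑ c, X ω b c) ^ 2) ∧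
    (∫ ω, ∑ a, (∑ b, X ω a b * ∑ c, X ω b c) ^ 2) ≤
      (2 * (2 + C) ^ 2 + 2 + 3 * C + C ^ 2) * (n : ℝ) ^ 3 := by
  have hC := h.C_nonneg
  have hη := h.eta_nonneg
  have hη' := h.eta_le'
  have hn := h.n_ge
  have key := sum_int fun a : Fin n => sum_int fun b : Fin n => 
    sum_int (F := fun d ω => lin (Xv X) (ee a b) ω * lin (Xv X) (rr b) ω *
      lin (Xv X) (ee a d) ω * lin (Xv X) (rr d) ω)
      (g := fun d : Fin n => dl b d * n + (2 * (2 + C) ^ 2 + 1 + 3 * C + C ^ 2))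
      (fun d => by
        obtain ⟨w1, w2⟩ := wick h.gauss (ee a b) (rr b) (ee a d) (rr d)
        refine ⟨w1, ?_⟩
        rw [w2]
        have p1 := h.er_le a b b
        have p2 := h.er_le a d d
        have p3 := h.K_row a b d
        have p4 := h.rr_le b d
        have p5 := h.er_le a b d
        have p6 : |qf (Xv X) (rr b) (ee a d)| ≤ 2 + C := by
          rw [qf_comm]; exact h.er_le a d b
        have d1 := dl_nonneg b d
        have d1' := dl_le_one b d
        have s1 := mul_le_mul p1 p2 (abs_nonneg _) (by linarith)
        have s2 := mul_le_mul p3 p4 (abs_nonneg _) (by linarith)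
        have s3 := mul_le_mul p5 p6 (abs_nonneg _) (by linarith)
        rw [← abs_mul] at s1 s2 s3
        have t1 := le_trans (le_abs_self _) s1
        have t2 := le_trans (le_abs_self _) s2
        have t3 := le_trans (le_abs_self _) s3
        have k : (dl b d + η) * (dl b d * n + (1 + C)) ≤ dl b d * n + (1 + 3 * C + C ^ 2) := by
          have : (dl b d + η) * (dl b d * n + (1 + C)) = (dl b d * dl b d) * n +
            dl b d * (1 + C) + dl b d * (n * η) + η * (1 + C) := by ring
          rw [this, dl_sq]
          have e1 := mul_le_mul_of_nonneg_right d1' (show 0 ≤ 1 + C by linarith)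
          have e2 := mul_le_mul d1' h.n_eta (by positivity) zero_le_one
          have e3 := mul_le_mul_of_nonneg_right hη' (show 0 ≤ 1 + C by linarith)
          linarith
        linarith)
  have hfun : (fun ω => ∑ a, (∑ b, X ω a b * ∑ c, X ω b c) ^ 2) = fun ω => ∑ a, ∑ b, ∑ d,
      lin (Xv X) (ee a b) ω * lin (Xv X) (rr b) ω *
      lin (Xv X) (ee a d) ω * lin (Xv X) (rr d) ω := by
    funext ω
    refine Finset.sum_congr rfl fun a _ => ?_
    simp only [lin_ee, lin_rr]
    rw [sq, Finset.sum_mul_sum]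
    refine Finset.sum_congr rfl fun c _ => Finset.sum_congr rfl fun d _ => ?_
    ring
  rw [hfun]
  refine ⟨key.1, key.2.trans (le_of_eq ?_)⟩
  simp only [Finset.sum_add_distrib, ← Finset.sum_mul, dl_sum, Finset.sum_const, Finset.card_univ,
    Fintype.card_fin, nsmul_eq_mul]
  ring

lemma m3 [IsProbabilityMeasure (volume : Measure Ω)] (h : Hyp X C η) :
    Integrable (fun ω => (∑ a, (∑ b, X ω a b) ^ 2 - (n : ℝ) ^ 2) ^ 2) ∧
    (∫ ω, (∑ a, (∑ b, X ω a b) ^ 2 - (n : ℝ) ^ 2) ^ 2) ≤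
      (C ^ 2 + 2 + 4 * (1 + C) + 2 * (1 + C) ^ 2) * (n : ℝ) ^ 3 := by
  have hC := h.C_nonneg
  have hn := h.n_ge
  have key := sum_int fun a : Fin n => 
    sum_int (F := fun d ω => (lin (Xv X) (rr a) ω ^ 2 - n) * (lin (Xv X) (rr d) ω ^ 2 - n))
      (g := fun d : Fin n => C ^ 2 + 2 * (dl a d * (n : ℝ) ^ 2 + 2 * (dl a d * n * (1 + C))
        + (1 + C) ^ 2))
      (fun d => by
        obtain ⟨w1, w2⟩ := wick h.gauss (rr a) (rr a) (rr d) (rr d)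
        have i1 := (lin_mul_integrable h.gauss (rr a) (rr a)).const_mul (n : ℝ)
        have i2 := (lin_mul_integrable h.gauss (rr d) (rr d)).const_mul (n : ℝ)
        have j1 : Integrable fun ω => lin (Xv X) (rr a) ω * lin (Xv X) (rr a) ω *
          lin (Xv X) (rr d) ω * lin (Xv X) (rr d) ω -
            n * (lin (Xv X) (rr a) ω * lin (Xv X) (rr a) ω) := w1.sub i1
        have j2 : Integrable fun ω => lin (Xv X) (rr a) ω * lin (Xv X) (rr a) ω *
          lin (Xv X) (rr d) ω * lin (Xv X) (rr d) ω -
            n * (lin (Xv X) (rr a) ω * lin (Xv X) (rr a) ω) -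
            n * (lin (Xv X) (rr d) ω * lin (Xv X) (rr d) ω) := j1.sub i2
        have j3 : Integrable fun _ : Ω => (n : ℝ) ^ 2 := integrable_const _
        have hfe : (fun ω => (lin (Xv X) (rr a) ω ^ 2 - n) * (lin (Xv X) (rr d) ω ^ 2 - n)) =
          fun ω => lin (Xv X) (rr a) ω * lin (Xv X) (rr a) ω *
          lin (Xv X) (rr d) ω * lin (Xv X) (rr d) ω -
            n * (lin (Xv X) (rr a) ω * lin (Xv X) (rr a) ω) -
            n * (lin (Xv X) (rr d) ω * lin (Xv X) (rr d) ω) + (n : ℝ) ^ 2 := by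
          funext ω; ring
        rw [hfe]
        refine ⟨j2.add j3, ?_⟩
        rw [integral_add j2 j3, integral_sub j1 i2, integral_sub w1 i1, w2, integral_const_mul,
          integral_const_mul]
        change _ - (n : ℝ) * qf (Xv X) (rr a) (rr a) - (n : ℝ) * qf (Xv X) (rr d) (rr d) + _ ≤ _
        simp only [integral_const, probReal_univ, smul_eq_mul, one_mul]
        have p1 := h.rr_diag a
        have p2 := h.rr_diag d
        have p3 := h.rr_le a d
        have s1 := mul_le_mul p1 p2 (abs_nonneg _) hC
        rw [← abs_mul] at s1
        have t1 := le_trans (le_abs_self _) s1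
        have d1 := dl_nonneg a d
        have s2 := mul_le_mul p3 p3 (abs_nonneg _) (by positivity)
        rw [abs_mul_abs_self] at s2
        have e : (dl a d * n + (1 + C)) * (dl a d * n + (1 + C)) = (dl a d * dl a d) * (n : ℝ) ^ 2 +
          2 * (dl a d * n * (1 + C)) + (1 + C) ^ 2 := by ring
        rw [e, dl_sq] at s2
        linarith)
  have hfun : (fun ω => (∑ a, (∑ b, X ω a b) ^ 2 - (n : ℝ) ^ 2) ^ 2) = fun ω => ∑ a, ∑ d,
      (lin (Xv X) (rr a) ω ^ 2 - n) * (lin (Xv X) (rr d) ω ^ 2 - n) := by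
    funext ω
    have : (∑ a, (∑ b, X ω a b) ^ 2 - (n : ℝ) ^ 2) = ∑ a, (lin (Xv X) (rr a) ω ^ 2 - n) := by
      simp [lin_rr, sq]
    rw [this, sq, Finset.sum_mul_sum]
  rw [hfun]
  refine ⟨key.1, key.2.trans ?_⟩
  simp only [Finset.sum_add_distrib, ← Finset.sum_mul, ← Finset.mul_sum, dl_sum, Finset.sum_const,
    Finset.card_univ, Fintype.card_fin, nsmul_eq_mul]
  have e2 : (n : ℝ) ^ 2 ≤ (n : ℝ) ^ 3 := pow_le_pow_right₀ hn (by norm_num)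
  have e3 := mul_le_mul_of_nonneg_right e2
    (show 0 ≤ C ^ 2 + 4 * (1 + C) + 2 * (1 + C) ^ 2 by positivity)
  linarith

lemma m4 (h : Hyp X C η) :
    Integrable (fun ω => (∑ a, ∑ b, X ω a b) ^ 2) ∧
    (∫ ω, (∑ a, ∑ b, X ω a b) ^ 2) ≤ (2 + C) * (n : ℝ) ^ 2 := by
  have key := sum_int fun a : Fin n => 
    sum_int (F := fun d ω => lin (Xv X) (rr a) ω * lin (Xv X) (rr d) ω)
      (g := fun d : Fin n => dl a d * n + (1 + C))
      (fun d => ⟨lin_mul_integrable h.gauss _ _, le_trans (le_abs_self _) (h.rr_le a d)⟩)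
  have hfun : (fun ω => (∑ a, ∑ b, X ω a b) ^ 2) = fun ω => ∑ a, ∑ d,
      lin (Xv X) (rr a) ω * lin (Xv X) (rr d) ω := by
    funext ω
    simp only [lin_rr]
    rw [sq, Finset.sum_mul_sum]
  rw [hfun]
  refine ⟨key.1, key.2.trans (le_of_eq ?_)⟩
  simp only [Finset.sum_add_distrib, ← Finset.sum_mul, dl_sum, Finset.sum_const, Finset.card_univ,
    Fintype.card_fin, nsmul_eq_mul]
  ring

end Hyp
end Moments


lemma gauss_weak (v : ℕ → NNReal) (hv : Tendsto (fun n => (v n : ℝ)) atTop (𝓝 2))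
    (f : BoundedContinuousFunction ℝ ℝ) :
    Tendsto (fun n => ∫ x, f x ∂(gaussianReal 0 (v n))) atTop
      (𝓝 (∫ x, f x ∂(gaussianReal 0 2))) := by
  have key : ∀ w : NNReal, (∫ x, f x ∂(gaussianReal 0 w)) =
      ∫ x, f (Real.sqrt w * x) ∂(gaussianReal 0 1) := by
    intro w
    have h1 : gaussianReal 0 w = (gaussianReal 0 1).map (Real.sqrt w * ·) := by
      rw [gaussianReal_map_const_mul]
      congr 1
      · simp
      · ext
        simp
    rw [h1, integral_map (by fun_prop) (by fun_prop)]
  simp_rw [key]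
  refine tendsto_integral_of_dominated_convergence (fun _ => ‖f‖) ?_ (integrable_const _) ?_ ?_
  · intro n
    exact (f.continuous.comp (continuous_const.mul continuous_id)).aestronglyMeasurable
  · intro n
    filter_upwards with x
    exact f.norm_coe_le_norm _
  · filter_upwards with x
    refine (f.continuous.tendsto _).comp ?_
    refine Tendsto.mul_const _ ?_
    exact (Real.continuous_sqrt.tendsto _).comp (by simpa using hv)

lemma abs_mul_pos' (q x : ℝ) (h : 0 < q) : |q * x| = q * |x| := by
  rw [abs_mul, abs_of_pos h]

lemma det_step {n : ℕ} (hn : 0 < n) (X : Matrix (Fin n) (Fin n) ℝ) (hX : X.IsSymm)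
    (lam s : ℝ) (hs : 1 ≤ s) (hsl : 4 * s ≤ lam) (hl : 16 ^ 2 * (s ^ 2 * n) ≤ lam ^ 4)
    (h1 : (∑ a, ∑ b, ((X * X) a b) ^ 2) ≤ s ^ 2 * (n : ℝ) ^ 3)
    (h2 : (∑ a, (∑ b, X a b * ∑ c, X b c) ^ 2) ≤ s ^ 2 * (n : ℝ) ^ 3)
    (h3 : (∑ a, (∑ b, X a b) ^ 2 - (n : ℝ) ^ 2) ^ 2 ≤ s ^ 2 * (n : ℝ) ^ 3)
    (h4 : (∑ a, ∑ b, X a b) ^ 2 ≤ s ^ 2 * (n : ℝ) ^ 2) :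
    |Real.sqrt n * (lam1 (((n : ℝ) ^ (-(1 / 2) : ℝ)) • (X + (lam / Real.sqrt n) • onesMat n))
        - lam - 1 / lam) - (1 / (n : ℝ)) * ∑ i, ∑ j, X i j| ≤
      100 * s ^ 3 * (1 / lam + Real.sqrt n / lam ^ 2) := by
  have hN : (1 : ℝ) ≤ n := by exact_mod_cast hn
  have hN0 : (0 : ℝ) < n := by linarith
  set q := Real.sqrt n with hq
  have hq1 : 1 ≤ q := Real.one_le_sqrt.mpr hN
  have hq0 : 0 < q := by linarith
  have hqq : q * q = n := Real.mul_self_sqrt hN0.le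
  have hpow : ((n : ℝ) ^ (-(1 / 2) : ℝ)) = q⁻¹ := by
    rw [Real.rpow_neg hN0.le, hq, Real.sqrt_eq_rpow]
  set W : Matrix (Fin n) (Fin n) ℝ := q⁻¹ • X with hWdef
  set u : Fin n → ℝ := fun _ => q⁻¹ with hu
  have hW : W.IsSymm := by
    rw [hWdef]; exact hX.smul _
  have hqi : q⁻¹ * q⁻¹ = (n : ℝ)⁻¹ := by rw [← mul_inv, hqq]
  have huu : u ⬝ᵥ u = 1 := by
    simp only [dotProduct, hu, hqi]
    simp [hN0.ne']
  have hWu : W.mulVec u = fun a => (n : ℝ)⁻¹ * ∑ b, X a b := by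
    funext a
    simp only [Matrix.mulVec, dotProduct, hWdef, hu, Matrix.smul_apply, smul_eq_mul]
    rw [Finset.mul_sum]
    refine Finset.sum_congr rfl fun b _ => ?_
    rw [← hqi]; ring
  have hWWu : W.mulVec (W.mulVec u) = fun a => q⁻¹ * (n : ℝ)⁻¹ * ∑ b, X a b * ∑ c, X b c := by
    rw [hWu]
    funext a
    simp only [Matrix.mulVec, dotProduct, hWdef, Matrix.smul_apply, smul_eq_mul]
    rw [Finset.mul_sum]
    refine Finset.sum_congr rfl fun b _ => ?_
    ring
  have ha : u ⬝ᵥ W.mulVec u = q⁻¹ * ((1 / (n : ℝ)) * ∑ i, ∑ j, X i j) := by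
    rw [hWu]
    simp only [dotProduct, hu]
    rw [← Finset.mul_sum, ← Finset.mul_sum, one_div]
  have hb : W.mulVec u ⬝ᵥ W.mulVec u - 1 =
      (1 / (n : ℝ) ^ 2) * (∑ a, (∑ b, X a b) ^ 2 - (n : ℝ) ^ 2) := by
    rw [hWu]
    simp only [dotProduct]
    have : ∀ a, ((n : ℝ)⁻¹ * ∑ b, X a b) * ((n : ℝ)⁻¹ * ∑ b, X a b) =
      (1 / (n : ℝ) ^ 2) * (∑ b, X a b) ^ 2 := by intro a; field_simp
    simp_rw [this]
    rw [← Finset.mul_sum, mul_sub]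
    congr 1
    field_simp
  have hd : W.mulVec (W.mulVec u) ⬝ᵥ W.mulVec (W.mulVec u) =
      (1 / (n : ℝ) ^ 3) * (∑ a, (∑ b, X a b * ∑ c, X b c) ^ 2) := by
    rw [hWWu]
    simp only [dotProduct]
    rw [Finset.mul_sum]
    refine Finset.sum_congr rfl fun a _ => ?_
    have : (1 / (n : ℝ) ^ 3) = q⁻¹ * q⁻¹ * (n : ℝ)⁻¹ * (n : ℝ)⁻¹ := by
      rw [hqi]; field_simp
    rw [this]; ring
  have hF : ∑ i, ∑ j, ((W * W) i j) ^ 2 = (1 / (n : ℝ) ^ 2) * ∑ a, ∑ b, ((X * X) a b) ^ 2 := by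
    have : W * W = (n : ℝ)⁻¹ • (X * X) := by
      rw [hWdef, Matrix.smul_mul, Matrix.mul_smul, smul_smul, hqi]
    rw [this]
    simp only [Matrix.smul_apply, smul_eq_mul, mul_pow]
    simp_rw [← Finset.mul_sum]
    simp
  have hM : (((n : ℝ) ^ (-(1 / 2) : ℝ)) • (X + (lam / q) • onesMat n)) =
      W + lam • Matrix.vecMulVec u u := by
    rw [hpow]
    ext i j
    simp only [onesMat, Matrix.smul_apply, Matrix.add_apply, Matrix.of_apply, smul_eq_mul,
      Matrix.vecMulVec_apply, hu, hWdef]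
    field_simp
  have hqS : q * (u ⬝ᵥ W.mulVec u) = (1 / (n : ℝ)) * ∑ i, ∑ j, X i j := by
    rw [ha]; field_simp
  have main := det_matrix hn W hW u huu lam q s hs hq1 hsl ?_ ?_ ?_ ?_
  · rw [hM, ← hqS]
    have : q * (lam1 (W + lam • Matrix.vecMulVec u u) - lam - 1 / lam) - q * (u ⬝ᵥ W.mulVec u) =
      q * (lam1 (W + lam • Matrix.vecMulVec u u) - lam - 1 / lam - u ⬝ᵥ W.mulVec u) := by ring
    rw [this, abs_mul, abs_of_pos hq0]
    exact main
  · rw [hF]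
    refine le_trans ?_ hl
    refine mul_le_mul_of_nonneg_left ?_ (by norm_num)
    rw [one_div, inv_mul_le_iff₀ (by positivity)]
    linarith
  · rw [← abs_mul_pos' _ _ hq0, hqS]
    refine abs_le_of_sq_le_sq ?_ (by linarith)
    rw [mul_pow, one_div, inv_pow, inv_mul_le_iff₀ (by positivity)]
    linarith
  · rw [← abs_mul_pos' _ _ hq0, hb]
    refine abs_le_of_sq_le_sq ?_ (by linarith)
    have : (q * (1 / (n : ℝ) ^ 2 * (∑ a, (∑ b, X a b) ^ 2 - (n : ℝ) ^ 2))) ^ 2 =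
      (1 / (n : ℝ) ^ 3) * (∑ a, (∑ b, X a b) ^ 2 - (n : ℝ) ^ 2) ^ 2 := by
      rw [mul_pow, pow_two q, hqq]; field_simp
    rw [this, one_div, inv_mul_le_iff₀ (by positivity)]
    linarith
  · rw [hd, one_div, inv_mul_le_iff₀ (by positivity)]
    linarith

section Final
variable {Ω : Type*} [MeasureSpace Ω]

/-- the control functional -/
noncomputable def Qn {n : ℕ} (X : Ω → Matrix (Fin n) (Fin n) ℝ) (ω : Ω) : ℝ :=
  (1 / (n : ℝ) ^ 3) * (∑ a, ∑ b, ((X ω * X ω) a b) ^ 2)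
  + (1 / (n : ℝ) ^ 3) * (∑ a, (∑ b, X ω a b * ∑ c, X ω b c) ^ 2)
  + (1 / (n : ℝ) ^ 3) * (∑ a, (∑ b, X ω a b) ^ 2 - (n : ℝ) ^ 2) ^ 2
  + (1 / (n : ℝ) ^ 2) * (∑ a, ∑ b, X ω a b) ^ 2

/-- the constant -/
noncomputable def KC (C : ℝ) : ℝ := (4 + 9 * C + 3 * C ^ 2) + (2 * (2 + C) ^ 2 + 2 + 3 * C + C ^ 2)
  + (C ^ 2 + 2 + 4 * (1 + C) + 2 * (1 + C) ^ 2) + (2 + C)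

lemma Qn_nonneg {n : ℕ} (X : Ω → Matrix (Fin n) (Fin n) ℝ) (ω : Ω) : 0 ≤ Qn X ω := by
  unfold Qn; positivity

lemma Qn_int [IsProbabilityMeasure (volume : Measure Ω)] {n : ℕ}
    {X : Ω → Matrix (Fin n) (Fin n) ℝ} {C η : ℝ} (h : Hyp X C η) :
    Integrable (Qn X) ∧ (∫ ω, Qn X ω) ≤ KC C := by
  have hN : (0 : ℝ) < n := by linarith [h.n_ge]
  obtain ⟨a1, b1⟩ := h.m1
  obtain ⟨a2, b2⟩ := h.m2
  obtain ⟨a3, b3⟩ := h.m3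
  obtain ⟨a4, b4⟩ := h.m4
  have c1 := a1.const_mul (1 / (n : ℝ) ^ 3)
  have c2 := a2.const_mul (1 / (n : ℝ) ^ 3)
  have c3 := a3.const_mul (1 / (n : ℝ) ^ 3)
  have c4 := a4.const_mul (1 / (n : ℝ) ^ 2)
  refine ⟨((c1.add c2).add c3).add c4, ?_⟩
  unfold Qn KC
  have e3 := integral_add ((c1.add c2).add c3) c4
  have e2 := integral_add (c1.add c2) c3
  have e1 := integral_add c1 c2
  simp only [Pi.add_apply] at e1 e2 e3
  rw [e3, e2, e1]
  simp only [integral_const_mul]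
  refine add_le_add (add_le_add (add_le_add ?_ ?_) ?_) ?_
  all_goals
    rw [one_div, inv_mul_le_iff₀ (by positivity)]
    linarith

lemma det_step' {n : ℕ} (hn : 0 < n) (X : Ω → Matrix (Fin n) (Fin n) ℝ)
    (hX : ∀ ω, (X ω).IsSymm)
    (lam s : ℝ) (hs : 1 ≤ s) (hsl : 4 * s ≤ lam) (hl : 16 ^ 2 * (s ^ 2 * n) ≤ lam ^ 4)
    (ω : Ω) (hQ : Qn X ω ≤ s ^ 2) :
    |Real.sqrt n * (lam1 (((n : ℝ) ^ (-(1 / 2) : ℝ)) • (X ω + (lam / Real.sqrt n) • onesMat n))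
        - lam - 1 / lam) - (1 / (n : ℝ)) * ∑ i, ∑ j, X ω i j| ≤
      100 * s ^ 3 * (1 / lam + Real.sqrt n / lam ^ 2) := by
  have hN : (0 : ℝ) < n := by exact_mod_cast hn
  have e1 : 0 ≤ (1 / (n : ℝ) ^ 3) * (∑ a, ∑ b, ((X ω * X ω) a b) ^ 2) := by positivity
  have e2 : 0 ≤ (1 / (n : ℝ) ^ 3) * (∑ a, (∑ b, X ω a b * ∑ c, X ω b c) ^ 2) := by positivity
  have e3 : 0 ≤ (1 / (n : ℝ) ^ 3) * (∑ a, (∑ b, X ω a b) ^ 2 - (n : ℝ) ^ 2) ^ 2 := by positivity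
  have e4 : 0 ≤ (1 / (n : ℝ) ^ 2) * (∑ a, ∑ b, X ω a b) ^ 2 := by positivity
  unfold Qn at hQ
  have k : ∀ (m : ℕ) (x : ℝ), (1 / (n : ℝ) ^ m) * x ≤ s ^ 2 → x ≤ s ^ 2 * (n : ℝ) ^ m := by
    intro m x hx
    rw [one_div, inv_mul_le_iff₀ (by positivity)] at hx
    linarith
  refine det_step hn (X ω) (hX ω) lam s hs hsl hl ?_ ?_ ?_ ?_ <;>
  · apply k
    linarith

lemma markov_Qn [IsProbabilityMeasure (volume : Measure Ω)] {n : ℕ}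
    {X : Ω → Matrix (Fin n) (Fin n) ℝ} {C η : ℝ} (h : Hyp X C η) (s : ℝ) (hs : 0 < s) :
    (volume : Measure Ω).real {ω | s ^ 2 ≤ Qn X ω} ≤ KC C / s ^ 2 := by
  obtain ⟨h1, h2⟩ := Qn_int h
  have := mul_meas_ge_le_integral_of_nonneg (μ := (volume : Measure Ω))
    (Filter.Eventually.of_forall (Qn_nonneg X)) h1 (s ^ 2)
  rw [le_div_iff₀ (by positivity), mul_comm]
  exact this.trans h2

lemma CorrGaussian.hyp {X : (n : ℕ) → Ω → Matrix (Fin n) (Fin n) ℝ} {C ε : ℝ}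
    (hC : 0 < C) (hε : 1 ≤ ε) (hX : CorrGaussian Ω X C ε) (n : ℕ) (hn : 0 < n) :
    Hyp (X n) C (C * (n : ℝ) ^ (-(1 + ε))) where
  npos := hn
  symm := hX.symm n
  gauss := hX.gauss n
  var_one := hX.var_one n
  corr_le := hX.corr_le n
  eta_nonneg := by positivity
  eta_le := by
    have hN : (1 : ℝ) ≤ n := by exact_mod_cast hn
    have h1 : (n : ℝ) ^ (-(1 + ε)) ≤ (n : ℝ) ^ (-2 : ℝ) :=
      Real.rpow_le_rpow_of_exponent_le hN (by linarith)
    have h2 : (n : ℝ) ^ (-2 : ℝ) = ((n : ℝ) ^ 2)⁻¹ := by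
      rw [Real.rpow_neg (by linarith)]; norm_num
    rw [h2] at h1
    calc (n : ℝ) ^ 2 * (C * (n : ℝ) ^ (-(1 + ε))) ≤ (n : ℝ) ^ 2 * (C * ((n : ℝ) ^ 2)⁻¹) := by gcongr
      _ = C := by field_simp

lemma lam_facts (lam : ℕ → ℝ)
    (hlam' : Tendsto (fun n : ℕ => lam n / (n : ℝ) ^ ((1 : ℝ) / 4)) atTop atTop) :
    (∀ s : ℝ, 1 ≤ s → ∀ᶠ n : ℕ in atTop, 4 * s ≤ lam n ∧ 16 ^ 2 * (s ^ 2 * n) ≤ lam n ^ 4) ∧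
    Tendsto (fun n : ℕ => 1 / lam n + Real.sqrt n / lam n ^ 2) atTop (𝓝 0) := by
  have hq2 : ∀ n : ℕ, ((n : ℝ) ^ ((1 : ℝ) / 4)) ^ 2 = Real.sqrt n := by
    intro n
    rw [← Real.rpow_natCast, ← Real.rpow_mul (by positivity), Real.sqrt_eq_rpow]; norm_num
  have hq4 : ∀ n : ℕ, ((n : ℝ) ^ ((1 : ℝ) / 4)) ^ 4 = n := by
    intro n
    rw [← Real.rpow_natCast, ← Real.rpow_mul (by positivity)]; norm_num
  have hq1 : ∀ n : ℕ, 1 ≤ n → 1 ≤ (n : ℝ) ^ ((1 : ℝ) / 4) := by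
    intro n hn
    exact Real.one_le_rpow (by exact_mod_cast hn) (by norm_num)
  have hge : ∀ M : ℝ, ∀ᶠ n : ℕ in atTop, 1 ≤ n ∧ M * (n : ℝ) ^ ((1 : ℝ) / 4) ≤ lam n := by
    intro M
    filter_upwards [hlam'.eventually_ge_atTop M, eventually_ge_atTop 1] with n h1 h2
    refine ⟨h2, ?_⟩
    have := hq1 n h2
    rwa [le_div_iff₀ (by linarith)] at h1
  constructor
  · intro s hs
    filter_upwards [hge (4 * s)] with n ⟨h1, h2⟩
    have h3 := hq1 n h1
    refine ⟨by nlinarith, ?_⟩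
    have h4 : (4 * s * (n : ℝ) ^ ((1 : ℝ) / 4)) ^ 4 ≤ lam n ^ 4 := by gcongr
    rw [mul_pow, hq4] at h4
    refine le_trans ?_ h4
    have h5 : s ^ 2 ≤ s ^ 4 := pow_le_pow_right₀ hs (by norm_num)
    have h6 : (0 : ℝ) ≤ n := by positivity
    nlinarith [mul_le_mul_of_nonneg_right h5 h6]
  · have t1 : Tendsto lam atTop atTop := by
      refine tendsto_atTop.mpr fun M => ?_
      filter_upwards [hge |M|] with n ⟨h1, h2⟩
      have := hq1 n h1
      nlinarith [abs_nonneg M, le_abs_self M]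
    have t2 : Tendsto (fun n => 1 / lam n) atTop (𝓝 0) := by
      simp only [one_div]
      exact t1.inv_tendsto_atTop
    have t3 : Tendsto (fun n : ℕ => Real.sqrt n / lam n ^ 2) atTop (𝓝 0) := by
      have := (hlam'.inv_tendsto_atTop).pow 2
      simp only [ne_eq, OfNat.ofNat_ne_zero, not_false_eq_true, zero_pow] at this
      refine this.congr fun n => ?_
      simp only [Pi.inv_apply, inv_div, div_pow, hq2]
    simpa using t2.add t3

lemma S_law [IsProbabilityMeasure (volume : Measure Ω)] {n : ℕ}
    {X : Ω → Matrix (Fin n) (Fin n) ℝ}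
    (h : IsCenteredGaussianVec (Xv X)) :
    Measurable (fun ω => (1 / (n : ℝ)) * ∑ i, ∑ j, X ω i j) ∧
    ∃ v : NNReal, Measure.map (fun ω => (1 / (n : ℝ)) * ∑ i, ∑ j, X ω i j) volume
        = gaussianReal 0 v ∧
      pvar (fun ω => (1 / (n : ℝ)) * ∑ i, ∑ j, X ω i j) = v := by
  have e : (fun ω => (1 / (n : ℝ)) * ∑ i, ∑ j, X ω i j) =
      fun ω => ∑ p, (1 / (n : ℝ)) * Xv X p ω := by
    funext ω
    rw [← Finset.mul_sum, Fintype.sum_prod_type]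
    rfl
  have hm : Measurable (fun ω => (1 / (n : ℝ)) * ∑ i, ∑ j, X ω i j) := by
    rw [e]
    exact Finset.measurable_sum _ fun p _ => (h.1 p).const_mul _
  refine ⟨hm, ?_⟩
  obtain ⟨v, hv⟩ := h.2 (fun _ => 1 / (n : ℝ))
  rw [← e] at hv
  refine ⟨v, hv, ?_⟩
  obtain ⟨g1, g2, -⟩ := gauss_moments v
  rw [← hv, integral_map hm.aemeasurable (by fun_prop)] at g1 g2
  unfold pvar pcov
  rw [g1]
  simp only [pow_two] at g2
  rw [g2]; simp
end Final
/-- Gaussian fluctuations when `ε ≥ 1` and `λ_n ≫ n^{1/4}`: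
`√n (λ₁(n^{-1/2} Y_n) - λ_n - 1/λ_n)` converges in distribution to `N(0, 2)`. -/
theorem fluctuations_eps_ge_one
    {Ω : Type*} [MeasureSpace Ω] [IsProbabilityMeasure (volume : Measure Ω)]
    (X : (n : ℕ) → Ω → Matrix (Fin n) (Fin n) ℝ) (C ε : ℝ)
    (hC : 0 < C) (hε : 1 ≤ ε) (hX : CorrGaussian Ω X C ε)
    (lam : ℕ → ℝ) (D : ℝ) (hD : 0 < D)
    (hlam : ∀ n : ℕ, 1 ≤ n → lam n ≤ D * Real.sqrt n)
    (hlam' : Tendsto (fun n : ℕ => lam n / (n : ℝ) ^ ((1 : ℝ) / 4)) atTop atTop)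
    (hvar : Tendsto
      (fun n : ℕ => pvar fun ω => (1 / (n : ℝ)) * ∑ i, ∑ j, X n ω i j) atTop (𝓝 2)) :
    ∀ f : BoundedContinuousFunction ℝ ℝ,
      Tendsto (fun n : ℕ => ∫ ω, f (Real.sqrt n *
          (lam1 (((n : ℝ) ^ (-(1 / 2) : ℝ)) •
              (X n ω + (lam n / Real.sqrt n) • onesMat n)) - lam n - 1 / lam n)))
        atTop (𝓝 (∫ x, f x ∂(gaussianReal 0 2))) := by
  intro f
  set T : ℕ → Ω → ℝ := fun n ω => Real.sqrt n *
          (lam1 (((n : ℝ) ^ (-(1 / 2) : ℝ)) •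
              (X n ω + (lam n / Real.sqrt n) • onesMat n)) - lam n - 1 / lam n) with hT
  set S : ℕ → Ω → ℝ := fun n ω => (1 / (n : ℝ)) * ∑ i, ∑ j, X n ω i j with hS
  have hTm : ∀ n, Measurable (T n) := by
    intro n
    have h1 : Measurable fun ω => lam1 (((n : ℝ) ^ (-(1 / 2) : ℝ)) •
              (X n ω + (lam n / Real.sqrt n) • onesMat n)) := by
      refine measurable_lam1 _ ?_ ?_
      · intro ω
        refine Matrix.IsSymm.smul (Matrix.IsSymm.add (hX.symm n ω) (Matrix.IsSymm.smul ?_ _)) _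
        ext i j
        simp [onesMat]
      · intro i j
        have h2 : Measurable fun ω => X n ω i j := (hX.gauss n).1 (i, j)
        simp only [Matrix.smul_apply, Matrix.add_apply, smul_eq_mul]
        exact (h2.add_const _).const_mul _
    exact ((h1.sub_const _).sub_const _).const_mul _
  have hSm : ∀ n, Measurable (S n) := fun n => (S_law (hX.gauss n)).1
  choose v hv hv' using fun n => (S_law (hX.gauss n)).2
  have hvt : Tendsto (fun n => (v n : ℝ)) atTop (𝓝 2) := hvar.congr hv'
  obtain ⟨l1, l2⟩ := lam_facts lam hlam'
  have hmeas : TendstoInMeasure volume (T - S) atTop 0 := by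
    rw [tendstoInMeasure_iff_measureReal_norm]
    intro δ hδ
    rw [Metric.tendsto_atTop']
    intro κ hκ
    obtain ⟨s, hs1, hs2⟩ : ∃ s : ℝ, 1 ≤ s ∧ KC C / s ^ 2 < κ := by
      have t : Tendsto (fun s : ℝ => KC C / s ^ 2) atTop (𝓝 0) :=
        tendsto_const_nhds.div_atTop (tendsto_pow_atTop (by norm_num))
      exact ((eventually_ge_atTop 1).and (t.eventually_lt_const hκ)).exists
    have l3 : Tendsto (fun n : ℕ => 100 * s ^ 3 * (1 / lam n + Real.sqrt n / lam n ^ 2))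
        atTop (𝓝 0) := by simpa using l2.const_mul (100 * s ^ 3)
    have hev := (l1 s hs1).and ((l3.eventually_lt_const hδ).and (eventually_ge_atTop 1))
    obtain ⟨n0, hn0⟩ := eventually_atTop.mp hev
    refine ⟨n0, fun n hn => ?_⟩
    obtain ⟨⟨k1, k2⟩, k3, k4⟩ := hn0 n hn.le
    have hyp := hX.hyp hC hε n k4
    rw [Real.dist_eq, sub_zero, abs_of_nonneg measureReal_nonneg]
    refine lt_of_le_of_lt ?_ hs2
    refine le_trans ?_ (markov_Qn hyp s (by linarith))
    refine measureReal_mono ?_ (measure_ne_top _ _)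
    intro ω hω
    by_contra hcon
    have hcon' : Qn (X n) ω ≤ s ^ 2 := (not_le.mp hcon).le
    have hdet := det_step' k4 (X n) (hX.symm n) (lam n) s hs1 k1 k2 ω hcon'
    have hω' : δ ≤ |T n ω - S n ω| := by
      have h0 : δ ≤ ‖(T - S) n ω - (0 : Ω → ℝ) ω‖ := hω
      simpa using h0
    exact absurd (hω'.trans hdet) (not_le.mpr k3)
  have hSd : TendstoInDistribution S atTop (id : ℝ → ℝ) (fun _ => volume) (gaussianReal 0 2) := by
    refine ⟨fun n => (hSm n).aemeasurable, aemeasurable_id, ?_⟩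
    refine ProbabilityMeasure.tendsto_iff_forall_integral_tendsto.mpr ?_
    intro g
    simp only [ProbabilityMeasure.coe_mk, Measure.map_id]
    refine (gauss_weak v hvt g).congr fun n => ?_
    rw [← hv n]
  have hTd := tendstoInDistribution_of_tendstoInMeasure_sub T id hSd hmeas
    (fun n => (hTm n).aemeasurable)
  have hfin := (ProbabilityMeasure.tendsto_iff_forall_integral_tendsto.mp hTd.tendsto) f
  simp only [ProbabilityMeasure.coe_mk, Measure.map_id] at hfin
  refine hfin.congr fun n => ?_
  rw [integral_map (hTm n).aemeasurable (by fun_prop)]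
end

section
/- Under the correlated Gaussian model with parameter ε > 0, let λ_n satisfy λ₀ ≤ λ_n ≤ D√n for fixed constants λ₀ > 0 and D > 0, set Y_n = X_n + (λ_n/√n)·𝟙𝟙ᵀ and S = Y_n𝟙. Then (λ_n/√n)·(⟨S, S⟩/⟨S, 𝟙⟩ − ⟨S, 𝟙⟩/n) − 1 = O_P(n^{−min{1,ε}/2}); that is, for every δ > 0 there exist M > 0 and n₀ such that P(|(λ_n/√n)·(⟨S,S⟩/⟨S,𝟙⟩ − ⟨S,𝟙⟩/n) − 1| > M·n^{−min{1,ε}/2}) ≤ δ for all n ≥ n₀ (with the convention that division by 0 yields 0). -/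
open MeasureTheory ProbabilityTheory Filter Topology

lemma gauss_m4 (v : NNReal) : ∫ x, x ^ 4 ∂(gaussianReal 0 v) = 3 * (v : ℝ) ^ 2 := by
  have h := iteratedDeriv_mgf_zero (X := id) (μ := gaussianReal 0 v) (by simp) 4
  have key : ∀ (p p' : ℝ → ℝ), (∀ t, HasDerivAt p (p' t) t) →
      deriv (fun t => p t * Real.exp ((v : ℝ) * t ^ 2 / 2)) =
        fun t => (p' t + v * t * p t) * Real.exp ((v : ℝ) * t ^ 2 / 2) := by
    intro p p' hp
    funext t
    have h2 : HasDerivAt (fun t : ℝ => (v : ℝ) * t ^ 2 / 2) (v * t) t := by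
      have := (((hasDerivAt_id t).pow 2).const_mul (v : ℝ)).div_const 2
      refine this.congr_deriv ?_
      simp
      ring
    have h3 : HasDerivAt (fun t => p t * Real.exp ((v : ℝ) * t ^ 2 / 2)) _ t := (hp t).mul h2.exp
    rw [h3.deriv]
    ring
  rw [mgf_id_gaussianReal] at h
  have e0 : (fun t : ℝ => Real.exp (0 * t + v * t ^ 2 / 2)) =
      fun t => (fun _ => (1 : ℝ)) t * Real.exp ((v : ℝ) * t ^ 2 / 2) := by
    funext t; simp
  rw [e0, iteratedDeriv_succ', iteratedDeriv_succ', iteratedDeriv_succ', iteratedDeriv_succ',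
    iteratedDeriv_zero,
    key (fun _ => 1) (fun _ => 0) (fun t => hasDerivAt_const t _),
    key (fun t => 0 + v * t * 1) (fun _ => v) (fun t => by
      simpa using (hasDerivAt_id t).const_mul (v : ℝ)),
    key (fun t => v + v * t * (0 + v * t * 1)) (fun t => 2 * v ^ 2 * t) (fun t => by
      have := (((hasDerivAt_id t).pow 2).const_mul ((v : ℝ) ^ 2)).const_add (v : ℝ)
      refine (this.congr_deriv ?_).congr_of_eventuallyEq (Eventually.of_forall fun x => ?_)
      · simp; ring
      · simp; ring),
    key (fun t => 2 * v ^ 2 * t + v * t * (v + v * t * (0 + v * t * 1)))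
      (fun t => 3 * v ^ 2 + 3 * v ^ 3 * t ^ 2) (fun t => by
      have := ((hasDerivAt_id t).const_mul (3 * (v : ℝ) ^ 2)).add
        (((hasDerivAt_id t).pow 3).const_mul ((v : ℝ) ^ 3))
      refine (this.congr_deriv ?_).congr_of_eventuallyEq (Eventually.of_forall fun x => ?_)
      · simp; ring
      · simp; ring)] at h
  simpa using h.symm

lemma gauss_m2 (v : NNReal) : ∫ x, x ^ 2 ∂(gaussianReal 0 v) = (v : ℝ) := by
  have h := variance_fun_id_gaussianReal (μ := 0) (v := v)
  rw [variance_eq_integral (by fun_prop)] at h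
  simpa using h

section
variable {Ω : Type*} [MeasureSpace Ω]

lemma gauss_rv {U : Ω → ℝ} (hU : Measurable U) {v : NNReal}
    (h : Measure.map U (volume : Measure Ω) = gaussianReal 0 v) :
    MemLp U 4 ∧ ∫ ω, U ω ^ 4 = 3 * (∫ ω, U ω ^ 2) ^ 2 := by
  have h4 := integral_map (μ := (volume : Measure Ω)) hU.aemeasurable
    (f := fun x : ℝ => x ^ 4) (by fun_prop)
  have h2 := integral_map (μ := (volume : Measure Ω)) hU.aemeasurable
    (f := fun x : ℝ => x ^ 2) (by fun_prop)
  rw [h, gauss_m4] at h4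
  rw [h, gauss_m2] at h2
  refine ⟨?_, by rw [← h4, ← h2]⟩
  have := memLp_id_gaussianReal' (μ := 0) (v := v) 4 (by simp)
  rw [← h] at this
  exact this.comp_of_map hU.aemeasurable

lemma memLp_mul2 {U V : Ω → ℝ} (hU : MemLp U 4) (hV : MemLp V 4) :
    MemLp (fun ω => U ω * V ω) 2 := by
  have : ENNReal.HolderTriple 4 4 2 := ⟨by
    rw [← ENNReal.toReal_eq_toReal_iff' (by simp) (by simp)]
    rw [ENNReal.toReal_add (by simp) (by simp)]
    norm_num [ENNReal.toReal_inv]⟩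
  exact hV.mul' hU

variable [IsProbabilityMeasure (volume : Measure Ω)]

lemma isserlis {U V : Ω → ℝ} (hU : Measurable U) (hV : Measurable V)
    (h : ∀ s t : ℝ, ∃ v : NNReal,
      Measure.map (fun ω => s * U ω + t * V ω) (volume : Measure Ω) = gaussianReal 0 v) :
    ∫ ω, U ω ^ 2 * V ω ^ 2 =
      (∫ ω, U ω ^ 2) * (∫ ω, V ω ^ 2) + 2 * (∫ ω, U ω * V ω) ^ 2 := by
  have hh : ∀ s t : ℝ, MemLp (fun ω => s * U ω + t * V ω) 4 ∧
      ∫ ω, (s * U ω + t * V ω) ^ 4 = 3 * (∫ ω, (s * U ω + t * V ω) ^ 2) ^ 2 := by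
    intro s t
    obtain ⟨v, hv⟩ := h s t
    exact gauss_rv (by fun_prop) hv
  have h10 := hh 1 0
  have h01 := hh 0 1
  have hp := hh 1 1
  have hm := hh 1 (-1)
  simp only [one_mul, zero_mul, add_zero, zero_add] at h10 h01 hp hm
  have mU := h10.1
  have mV := h01.1
  have UU := memLp_mul2 mU mU
  have VV := memLp_mul2 mV mV
  have UV := memLp_mul2 mU mV
  have iUU : Integrable (fun ω => U ω ^ 2) := by
    simpa [sq] using UU.integrable (by norm_num)
  have iVV : Integrable (fun ω => V ω ^ 2) := by
    simpa [sq] using VV.integrable (by norm_num)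
  have iUV : Integrable (fun ω => U ω * V ω) := UV.integrable (by norm_num)
  have i4 : ∀ {W : Ω → ℝ}, MemLp W 4 → Integrable (fun ω => W ω ^ 4) := by
    intro W hW
    have := (memLp_mul2 hW hW).integrable_sq
    refine this.congr (Eventually.of_forall fun ω => ?_)
    simp only; ring
  have iU2V2 : Integrable (fun ω => U ω ^ 2 * V ω ^ 2) := by
    refine UV.integrable_sq.congr (Eventually.of_forall fun ω => ?_)
    simp only; ring
  have iS : Integrable (fun ω => U ω ^ 2 + V ω ^ 2) := iUU.add iVV
  have jU := i4 mU
  have jV := i4 mV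
  have jp := i4 hp.1
  have jm := i4 hm.1
  have jS : Integrable (fun ω => 2 * U ω ^ 4 + 2 * V ω ^ 4) :=
    (jU.const_mul 2).add (jV.const_mul 2)
  have e1 : ∫ ω, (U ω + V ω) ^ 2 = (∫ ω, U ω ^ 2) + (∫ ω, V ω ^ 2) + 2 * ∫ ω, U ω * V ω := by
    rw [← integral_const_mul, ← integral_add iUU iVV, ← integral_add iS (iUV.const_mul 2)]
    congr 1; funext ω; ring
  have e2 : ∫ ω, (U ω + -1 * V ω) ^ 2 = (∫ ω, U ω ^ 2) + (∫ ω, V ω ^ 2) - 2 * ∫ ω, U ω * V ω := by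
    rw [← integral_const_mul, ← integral_add iUU iVV, ← integral_sub iS (iUV.const_mul 2)]
    congr 1; funext ω; ring
  have e3 : (∫ ω, (U ω + V ω) ^ 4) + (∫ ω, (U ω + -1 * V ω) ^ 4) =
      2 * (∫ ω, U ω ^ 4) + 2 * (∫ ω, V ω ^ 4) + 12 * ∫ ω, U ω ^ 2 * V ω ^ 2 := by
    rw [← integral_const_mul, ← integral_const_mul, ← integral_const_mul, ← integral_add jp jm,
      ← integral_add (jU.const_mul 2) (jV.const_mul 2),
      ← integral_add jS (iU2V2.const_mul 12)]
    congr 1; funext ω; ring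
  rw [hp.2, hm.2, e1, e2, h10.2, h01.2] at e3
  linarith

/-- Row sums of a symmetric Gaussian matrix at a fixed size. -/
structure RowModel (n : ℕ) (x : Fin n → Fin n → Ω → ℝ) (κ : ℝ) : Prop where
  symm : ∀ i j ω, x i j ω = x j i ω
  gauss : IsCenteredGaussianVec fun p : Fin n × Fin n => x p.1 p.2
  var_one : ∀ i j, ∫ ω, x i j ω ^ 2 = 1
  corr_le : ∀ i j i' j' : Fin n, ¬((i, j) = (i', j') ∨ (i, j) = (j', i')) →
    |∫ ω, x i j ω * x i' j' ω| ≤ κ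
  nonneg : 0 ≤ κ

namespace RowModel
variable {n : ℕ} {x : Fin n → Fin n → Ω → ℝ} {κ : ℝ}

lemma meas (h : RowModel n x κ) (i j) : Measurable (x i j) := h.gauss.1 (i, j)

lemma memx (h : RowModel n x κ) (i j) : MemLp (x i j) 4 := by
  obtain ⟨v, hv⟩ := h.gauss.2 (fun p => if p = (i, j) then 1 else 0)
  simp only [ite_mul, one_mul, zero_mul, Finset.sum_ite_eq', Finset.mem_univ, if_true] at hv
  exact (gauss_rv (h.meas i j) hv).1

lemma memr (h : RowModel n x κ) (i) : MemLp (fun ω => ∑ j, x i j ω) 4 :=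
  memLp_finsetSum _ fun j _ => h.memx i j

lemma gr (h : RowModel n x κ) (i k : Fin n) (s t : ℝ) : ∃ v : NNReal,
    Measure.map (fun ω => s * (∑ j, x i j ω) + t * ∑ j, x k j ω) (volume : Measure Ω)
      = gaussianReal 0 v := by
  obtain ⟨v, hv⟩ := h.gauss.2
    (fun p => (if p.1 = i then s else 0) + (if p.1 = k then t else 0))
  refine ⟨v, ?_⟩
  rw [← hv]
  congr 1
  funext ω
  simp only [add_mul, Finset.sum_add_distrib, ite_mul, zero_mul, Fintype.sum_prod_type]
  congr 1
  · rw [Finset.mul_sum]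
    symm
    rw [Finset.sum_eq_single i (by intro b _ hb; simp [hb]) (by simp)]
    simp
  · rw [Finset.mul_sum]
    symm
    rw [Finset.sum_eq_single k (by intro b _ hb; simp [hb]) (by simp)]
    simp

lemma cov_entry (h : RowModel n x κ) (i j i' j' : Fin n) :
    |(∫ ω, x i j ω * x i' j' ω) -
      (if (i = i' ∧ j = j') ∨ (i = j' ∧ j = i') then 1 else 0)| ≤ κ := by
  split_ifs with hc
  · have : (∫ ω, x i j ω * x i' j' ω) = 1 := by
      rw [← h.var_one i j]
      congr 1
      funext ω
      rcases hc with ⟨rfl, rfl⟩ | ⟨rfl, rfl⟩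
      · ring
      · rw [h.symm j i, sq]
    rw [this]
    simpa using h.nonneg
  · simpa using h.corr_le i j i' j' (by simpa using hc)

lemma row_cov_eq (h : RowModel n x κ) (i k : Fin n) :
    ∫ ω, (∑ j, x i j ω) * (∑ j, x k j ω) = ∑ j, ∑ j', ∫ ω, x i j ω * x k j' ω := by
  have hi : ∀ j j', Integrable (fun ω => x i j ω * x k j' ω) := fun j j' =>
    (memLp_mul2 (h.memx i j) (h.memx k j')).integrable (by norm_num)
  simp_rw [Finset.sum_mul_sum]
  rw [integral_finsetSum _ (fun j _ => integrable_finsetSum _ fun j' _ => hi j j')]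
  refine Finset.sum_congr rfl fun j _ => ?_
  rw [integral_finsetSum _ (fun j' _ => hi j j')]

lemma row_cov (h : RowModel n x κ) (i k : Fin n) :
    |(∫ ω, (∑ j, x i j ω) * (∑ j, x k j ω)) - (if i = k then (n : ℝ) else 1)| ≤ n ^ 2 * κ := by
  have e : (if i = k then (n : ℝ) else 1) = ∑ j : Fin n, ∑ j' : Fin n,
      (if (i = k ∧ j = j') ∨ (i = j' ∧ j = k) then (1 : ℝ) else 0) := by
    split_ifs with hik
    · subst hik
      have : ∀ j j' : Fin n, ((i = i ∧ j = j') ∨ (i = j' ∧ j = i)) ↔ j = j' := by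
        intro j j'
        constructor
        · rintro (⟨_, h⟩ | ⟨h1, h2⟩)
          · exact h
          · exact h2.trans h1
        · intro h; exact Or.inl ⟨rfl, h⟩
      refine Eq.trans ?_ (Finset.sum_congr rfl fun j _ => Finset.sum_congr rfl fun j' _ =>
        (if_congr (this j j') rfl rfl).symm)
      simp
    · rw [Finset.sum_eq_single k]
      · simp [hik]
      · intro b _ hb; simp [hb, hik]
      · simp
  rw [h.row_cov_eq, e, ← Finset.sum_sub_distrib]
  simp_rw [← Finset.sum_sub_distrib]
  calc _ ≤ ∑ j : Fin n, ∑ j' : Fin n, κ :=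
        (Finset.abs_sum_le_sum_abs _ _).trans (Finset.sum_le_sum fun j _ =>
          (Finset.abs_sum_le_sum_abs _ _).trans (Finset.sum_le_sum fun j' _ =>
            h.cov_entry i j k j'))
    _ = n ^ 2 * κ := by simp; ring

lemma R_bound (h : RowModel n x κ) :
    ∫ ω, (∑ i, ∑ j, x i j ω) ^ 2 ≤ 2 * n ^ 2 + n ^ 4 * κ := by
  have hi : ∀ i k, Integrable (fun ω => (∑ j, x i j ω) * (∑ j, x k j ω)) := fun i k =>
    (memLp_mul2 (h.memr i) (h.memr k)).integrable (by norm_num)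
  have e : ∫ ω, (∑ i, ∑ j, x i j ω) ^ 2 =
      ∑ i, ∑ k, ∫ ω, (∑ j, x i j ω) * (∑ j, x k j ω) := by
    simp_rw [sq, Finset.sum_mul_sum (s := Finset.univ) (t := Finset.univ)
      (f := fun i => ∑ j, x i j _)]
    rw [integral_finsetSum _ (fun j _ => integrable_finsetSum _ fun j' _ => hi j j')]
    refine Finset.sum_congr rfl fun j _ => ?_
    rw [integral_finsetSum _ (fun j' _ => hi j j')]
  rw [e]
  calc _ ≤ ∑ i : Fin n, ∑ k : Fin n, ((if i = k then (n : ℝ) else 0) + 1 + n ^ 2 * κ) := by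
        refine Finset.sum_le_sum fun i _ => Finset.sum_le_sum fun k _ => ?_
        have := (abs_le.1 (h.row_cov i k)).2
        split_ifs at this ⊢ <;> linarith
    _ = _ := by simp [Finset.sum_add_distrib]; ring

lemma Q_int (h : RowModel n x κ) :
    MemLp (fun ω => (∑ i, (∑ j, x i j ω) ^ 2) - (n : ℝ) ^ 2) 2 := by
  have h1 : ∀ i, MemLp (fun ω => (∑ j, x i j ω) ^ 2) 2 := fun i => by
    have := memLp_mul2 (h.memr i) (h.memr i)
    simp only [← sq] at this
    exact this
  have h2 : MemLp (fun ω => ∑ i, (∑ j, x i j ω) ^ 2) 2 := memLp_finsetSum _ fun i _ => h1 i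
  have h3 : MemLp (fun _ : Ω => (n : ℝ) ^ 2) 2 := memLp_const _
  exact h2.sub h3

lemma Q_bound (h : RowModel n x κ) :
    ∫ ω, ((∑ i, (∑ j, x i j ω) ^ 2) - (n : ℝ) ^ 2) ^ 2 ≤
      5 * n ^ 6 * κ ^ 2 + 4 * n ^ 3 + 4 * n ^ 2 := by
  set r : Fin n → Ω → ℝ := fun i ω => ∑ j, x i j ω with hr
  set c : Fin n → Fin n → ℝ := fun i k => ∫ ω, r i ω * r k ω with hc
  have hcov : ∀ i k, |c i k - (if i = k then (n : ℝ) else 1)| ≤ n ^ 2 * κ := h.row_cov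
  have rr : ∀ i k, MemLp (fun ω => r i ω * r k ω) 2 := fun i k => memLp_mul2 (h.memr i) (h.memr k)
  have i2 : ∀ i, Integrable (fun ω => r i ω ^ 2) := fun i => by
    simpa [sq] using (rr i i).integrable (by norm_num)
  have i22 : ∀ i k, Integrable (fun ω => r i ω ^ 2 * r k ω ^ 2) := fun i k => by
    refine (rr i k).integrable_sq.congr (Eventually.of_forall fun ω => ?_)
    simp only; ring
  have hiss : ∀ i k, ∫ ω, r i ω ^ 2 * r k ω ^ 2 = c i i * c k k + 2 * c i k ^ 2 := by
    intro i k
    have hm : ∀ i, Measurable (r i) := fun i =>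
      Finset.measurable_fun_sum _ fun j _ => h.meas i j
    rw [isserlis (hm i) (hm k) (h.gr i k)]
    simp only [hc, sq]
  have iQ : Integrable (fun ω => ∑ i, r i ω ^ 2) := integrable_finsetSum _ fun i _ => i2 i
  have iQQ : Integrable (fun ω => ∑ i, ∑ k, r i ω ^ 2 * r k ω ^ 2) :=
    integrable_finsetSum _ fun i _ => integrable_finsetSum _ fun k _ => i22 i k
  have eQ : ∫ ω, ∑ i, r i ω ^ 2 = ∑ i, c i i := by
    rw [integral_finsetSum _ fun i _ => i2 i]
    simp only [hc, sq]
  have eQQ : ∫ ω, ∑ i, ∑ k, r i ω ^ 2 * r k ω ^ 2 =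
      ∑ i, ∑ k, (c i i * c k k + 2 * c i k ^ 2) := by
    rw [integral_finsetSum _ (fun j _ => integrable_finsetSum _ fun j' _ => i22 j j')]
    refine Finset.sum_congr rfl fun j _ => ?_
    rw [integral_finsetSum _ (fun j' _ => i22 j j')]
    exact Finset.sum_congr rfl fun k _ => hiss j k
  have e : ∫ ω, ((∑ i, r i ω ^ 2) - (n : ℝ) ^ 2) ^ 2 =
      ((∑ i, c i i) - (n : ℝ) ^ 2) ^ 2 + 2 * ∑ i, ∑ k, c i k ^ 2 := by
    have e1 : (fun ω => ((∑ i, r i ω ^ 2) - (n : ℝ) ^ 2) ^ 2) = fun ω =>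
        ((∑ i, ∑ k, r i ω ^ 2 * r k ω ^ 2) - 2 * (n : ℝ) ^ 2 * ∑ i, r i ω ^ 2) + n ^ 4 := by
      funext ω
      rw [← Finset.sum_mul_sum]
      ring
    have iD : Integrable (fun ω =>
        (∑ i, ∑ k, r i ω ^ 2 * r k ω ^ 2) - 2 * (n : ℝ) ^ 2 * ∑ i, r i ω ^ 2) :=
      iQQ.sub (iQ.const_mul _)
    rw [e1, integral_add iD (integrable_const _), integral_sub iQQ (iQ.const_mul _),
      integral_const_mul, eQ, eQQ]
    simp only [Finset.sum_add_distrib, ← Finset.mul_sum, ← Finset.sum_mul]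
    simp
    ring
  change ∫ ω, ((∑ i, r i ω ^ 2) - (n : ℝ) ^ 2) ^ 2 ≤ _
  rw [e]
  have b1 : |(∑ i, c i i) - (n : ℝ) ^ 2| ≤ n ^ 3 * κ := by
    have : (∑ i, c i i) - (n : ℝ) ^ 2 = ∑ i, (c i i - n) := by
      simp [Finset.sum_sub_distrib]; ring
    rw [this]
    calc _ ≤ ∑ i : Fin n, (n : ℝ) ^ 2 * κ :=
          (Finset.abs_sum_le_sum_abs _ _).trans (Finset.sum_le_sum fun i _ => by
            simpa using hcov i i)
      _ = _ := by simp; ring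
  have b1' := sq_le_sq' (abs_le.1 b1).1 (abs_le.1 b1).2
  have b2 : ∑ i, ∑ k, c i k ^ 2 ≤
      ∑ i : Fin n, ∑ k : Fin n, (2 * ((if i = k then (n : ℝ) ^ 2 else 0) + 1)
        + 2 * (n ^ 2 * κ) ^ 2) := by
    refine Finset.sum_le_sum fun i _ => Finset.sum_le_sum fun k _ => ?_
    have h0 := hcov i k
    have h1 := sq_le_sq' (abs_le.1 h0).1 (abs_le.1 h0).2
    split_ifs at h1 ⊢
    · nlinarith [sq_nonneg (c i k - n - n)]
    · nlinarith [sq_nonneg (c i k - 1 - 1)]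
  have b3 : ∑ i : Fin n, ∑ k : Fin n, (2 * ((if i = k then (n : ℝ) ^ 2 else 0) + 1)
        + 2 * (n ^ 2 * κ) ^ 2) = 2 * (n ^ 3 + n ^ 2) + 2 * n ^ 6 * κ ^ 2 := by
    simp [Finset.sum_add_distrib, ← Finset.mul_sum]; ring
  nlinarith

end RowModel

lemma cheb {A : Ω → ℝ} (hA : MemLp A 2) {m K a : ℝ} (hm : 0 < m) (ha : 0 < a)
    (hK : ∫ ω, A ω ^ 2 ≤ K * a ^ 2) :
    (volume : Measure Ω).real {ω | m * a < |A ω|} ≤ K / m ^ 2 := by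
  have h1 := mul_meas_ge_le_integral_of_nonneg (μ := (volume : Measure Ω))
    (f := fun ω => A ω ^ 2) (Eventually.of_forall fun ω => sq_nonneg _) hA.integrable_sq
    ((m * a) ^ 2)
  have h2 : (volume : Measure Ω).real {ω | m * a < |A ω|} ≤
      (volume : Measure Ω).real {ω | (m * a) ^ 2 ≤ A ω ^ 2} := by
    refine measureReal_mono fun ω hω => ?_
    have hω' : m * a < |A ω| := hω
    change (m * a) ^ 2 ≤ A ω ^ 2
    rw [← sq_abs (A ω)]
    exact pow_le_pow_left₀ (by positivity) hω'.le 2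
  rw [le_div_iff₀ (by positivity)]
  have h3 : (m * a) ^ 2 * (volume : Measure Ω).real {ω | m * a < |A ω|} ≤ K * a ^ 2 :=
    (mul_le_mul_of_nonneg_left h2 (by positivity)).trans (h1.trans hK)
  have ha2 : 0 < a ^ 2 := by positivity
  refine le_of_mul_le_mul_right ?_ ha2
  linarith

end

lemma det_bound {n l l0 a m Q R : ℝ} (hn : 0 < n) (hl0 : 0 < l0) (hl : l0 ≤ l)
    (ha : 0 < a) (hm : 0 < m) (h1 : m * a ≤ 1) (h2 : m * a ≤ l0 / 2)
    (hA : |(Q - n ^ 2) / n ^ 2| ≤ m * a) (hW : |R / (n * √n)| ≤ m * a) :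
    |(l / √n) * ((Q + 2 * (l / √n * n) * R + n * (l / √n * n) ^ 2) / (R + n * (l / √n * n))
      - (R + n * (l / √n * n)) / n) - 1| ≤ 2 * m * (2 + 1 / l0) * a := by
  obtain ⟨s, hs, rfl⟩ : ∃ s : ℝ, 0 < s ∧ n = s ^ 2 :=
    ⟨√n, Real.sqrt_pos.2 hn, (Real.sq_sqrt hn.le).symm⟩
  rw [Real.sqrt_sq hs.le] at *
  have hlpos : 0 < l := hl0.trans_le hl
  set A := (Q - (s ^ 2) ^ 2) / (s ^ 2) ^ 2 with hAdef
  set W := R / (s ^ 2 * s) with hWdef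
  have eQ : Q = s ^ 4 * (A + 1) := by rw [hAdef]; field_simp; ring
  have eR : R = s ^ 3 * W := by rw [hWdef]; field_simp
  have hw : |W / l| ≤ 1 / 2 := by
    rw [abs_div, abs_of_pos hlpos, div_le_iff₀ hlpos]
    linarith
  have hwl : |W / l| ≤ m * a * (1 / l0) := by
    rw [abs_div, abs_of_pos hlpos, div_eq_mul_one_div]
    exact mul_le_mul hW (one_div_le_one_div_of_le hl0 hl) (by positivity) (by positivity)
  have hden : 1 / 2 ≤ 1 + W / l := by linarith [(abs_le.1 hw).1]
  have hden' : 0 < 1 + W / l := by linarith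
  have hden2 : l + W ≠ 0 := by
    have : l + W = l * (1 + W / l) := by field_simp
    rw [this]; positivity
  have key : (l / s) * ((Q + 2 * (l / s * s ^ 2) * R + s ^ 2 * (l / s * s ^ 2) ^ 2) /
      (R + s ^ 2 * (l / s * s ^ 2)) - (R + s ^ 2 * (l / s * s ^ 2)) / s ^ 2) - 1 =
      (A - W ^ 2 - W / l) / (1 + W / l) := by
    have d : R + s ^ 2 * (l / s * s ^ 2) = s ^ 3 * (l + W) := by
      rw [eR]; field_simp; ring
    have d2 : 1 + W / l = (l + W) / l := by field_simp
    rw [d, d2, eQ, eR]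
    field_simp
    ring
  rw [key, abs_div, abs_of_pos hden', div_le_iff₀ hden']
  have hW2 : W ^ 2 ≤ m * a := by
    have : |W| ^ 2 ≤ (m * a) ^ 2 := pow_le_pow_left₀ (abs_nonneg _) hW 2
    rw [sq_abs] at this
    have hp : 0 < m * a := by positivity
    nlinarith
  have hnum : |A - W ^ 2 - W / l| ≤ m * a * (2 + 1 / l0) := by
    have t1 := abs_sub (A - W ^ 2) (W / l)
    have t2 := abs_sub A (W ^ 2)
    rw [abs_of_nonneg (sq_nonneg W)] at t2
    linarith
  have hpos : 0 ≤ m * a * (2 + 1 / l0) := by positivity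
  nlinarith

/-- `(λ_n/√n)(⟨S,S⟩/⟨S,𝟙⟩ - ⟨S,𝟙⟩/n) - 1 = O_P(n^{-min{1,ε}/2})`, where
`S = Y_n 𝟙` and `Y_n = X_n + (λ_n/√n) 𝟙𝟙ᵀ`. -/
theorem rayleigh_vs_average
    {Ω : Type*} [MeasureSpace Ω] [IsProbabilityMeasure (volume : Measure Ω)]
    (X : (n : ℕ) → Ω → Matrix (Fin n) (Fin n) ℝ) (C ε : ℝ)
    (hC : 0 < C) (hε : 0 < ε) (hX : CorrGaussian Ω X C ε)
    (lam : ℕ → ℝ) (lam₀ D : ℝ) (hlam₀ : 0 < lam₀) (hD : 0 < D)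
    (hlam : ∀ n : ℕ, 1 ≤ n → lam₀ ≤ lam n ∧ lam n ≤ D * Real.sqrt n) :
    IsBigOP
      (fun n ω =>
        (lam n / Real.sqrt n) *
            ((∑ i, (∑ j, (X n ω + (lam n / Real.sqrt n) • onesMat n) i j) ^ 2) /
                (∑ i, ∑ j, (X n ω + (lam n / Real.sqrt n) • onesMat n) i j) -
              (∑ i, ∑ j, (X n ω + (lam n / Real.sqrt n) • onesMat n) i j) / (n : ℝ)) - 1)
      (fun n => (n : ℝ) ^ (-(min 1 ε) / 2)) := by
  intro δ hδ
  set K : ℝ := 5 * C ^ 2 + C + 10 with hK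
  have hKpos : 0 < K := by positivity
  obtain ⟨m, hm, hmK⟩ : ∃ m : ℝ, 0 < m ∧ K / m ^ 2 ≤ δ / 2 := by
    refine ⟨√(2 * K / δ), by positivity, ?_⟩
    rw [Real.sq_sqrt (by positivity)]
    apply le_of_eq
    field_simp
  have hmin : 0 < min 1 ε := lt_min one_pos hε
  have htend : Tendsto (fun n : ℕ => m * (n : ℝ) ^ (-(min 1 ε) / 2)) atTop (𝓝 0) := by
    have h1 := (tendsto_rpow_neg_atTop (y := min 1 ε / 2) (by positivity)).comp
      (tendsto_natCast_atTop_atTop (R := ℝ))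
    have h2 := h1.const_mul m
    simpa [neg_div, Function.comp_def] using h2
  have hev : ∀ᶠ n : ℕ in atTop, 1 ≤ n ∧ m * (n : ℝ) ^ (-(min 1 ε) / 2) < min 1 (lam₀ / 2) :=
    (eventually_ge_atTop 1).and (htend.eventually_lt_const (by positivity))
  obtain ⟨n₀, hn₀⟩ := eventually_atTop.1 hev
  refine ⟨2 * m * (2 + 1 / lam₀), by positivity, n₀, fun n hn => ?_⟩
  obtain ⟨hn1, hsmall⟩ := hn₀ n hn
  have hlam' := (hlam n hn1).1
  have hnpos : (0 : ℝ) < n := by exact_mod_cast hn1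
  have hnone : (1 : ℝ) ≤ n := by exact_mod_cast hn1
  set a : ℝ := (n : ℝ) ^ (-(min 1 ε) / 2) with ha
  have hapos : 0 < a := Real.rpow_pos_of_pos hnpos _
  have ha2 : a ^ 2 = (n : ℝ) ^ (-(min 1 ε)) := by
    rw [ha, ← Real.rpow_natCast, ← Real.rpow_mul hnpos.le]
    congr 1
    push_cast
    ring
  have ha2n : 1 / (n : ℝ) ≤ a ^ 2 := by
    rw [ha2, one_div, ← Real.rpow_neg_one]
    exact Real.rpow_le_rpow_of_exponent_le hnone (neg_le_neg (min_le_left _ _))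
  set β : ℝ := (n : ℝ) ^ (-ε) with hβ
  have hβpos : 0 < β := Real.rpow_pos_of_pos hnpos _
  have hβa : β ≤ a ^ 2 := by
    rw [ha2]
    exact Real.rpow_le_rpow_of_exponent_le hnone (neg_le_neg (min_le_right _ _))
  have hβ1 : β ≤ 1 := Real.rpow_le_one_of_one_le_of_nonpos hnone (by linarith)
  set κ : ℝ := C * (n : ℝ) ^ (-(1 + ε)) with hκ
  have hnκ : κ = C * β / n := by
    rw [hκ, neg_add, Real.rpow_add hnpos, Real.rpow_neg_one, ← hβ]
    field_simp
  have hrow : RowModel n (fun i j ω => X n ω i j) κ :=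
    { symm := fun i j ω => (hX.symm n ω).apply j i
      gauss := hX.gauss n
      var_one := hX.var_one n
      corr_le := hX.corr_le n
      nonneg := by positivity }
  have hAmem : MemLp (fun ω => ((∑ i, (∑ j, X n ω i j) ^ 2) - (n : ℝ) ^ 2) / (n : ℝ) ^ 2) 2 := by
    have := hrow.Q_int.const_mul (1 / (n : ℝ) ^ 2)
    simpa [div_eq_inv_mul] using this
  have hA2 : ∫ ω, (((∑ i, (∑ j, X n ω i j) ^ 2) - (n : ℝ) ^ 2) / (n : ℝ) ^ 2) ^ 2
      ≤ K * a ^ 2 := by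
    simp_rw [div_pow _ ((n : ℝ) ^ 2)]
    rw [integral_div]
    have hb := hrow.Q_bound
    calc _ ≤ (5 * n ^ 6 * κ ^ 2 + 4 * n ^ 3 + 4 * n ^ 2) / ((n : ℝ) ^ 2) ^ 2 := by gcongr
      _ = 5 * C ^ 2 * (β * β) + 4 * (1 / n) + 4 * (1 / n * (1 / n)) := by
        rw [hnκ]; field_simp
      _ ≤ 5 * C ^ 2 * a ^ 2 + 4 * a ^ 2 + 4 * a ^ 2 := by
        have t1 : β * β ≤ a ^ 2 := by nlinarith
        have t2 : 1 / (n : ℝ) * (1 / n) ≤ a ^ 2 := by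
          have : 1 / (n : ℝ) ≤ 1 := by rw [div_le_one hnpos]; exact hnone
          have t0 : 0 < 1 / (n : ℝ) := by positivity
          nlinarith
        gcongr
      _ ≤ K * a ^ 2 := by
        rw [hK]
        have : 0 < a ^ 2 := by positivity
        nlinarith [mul_pos hC this]
  have hWmem : MemLp (fun ω => (∑ i, ∑ j, X n ω i j) / ((n : ℝ) * √n)) 2 := by
    have h1 : MemLp (fun ω => ∑ i, ∑ j, X n ω i j) 4 :=
      memLp_finsetSum _ fun i _ => hrow.memr i
    have h2 : MemLp (fun ω => ∑ i, ∑ j, X n ω i j) 2 := h1.mono_exponent (by norm_num)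
    have := h2.const_mul (1 / ((n : ℝ) * √n))
    simpa only [one_div, div_eq_inv_mul, mul_one] using this
  have hW2 : ∫ ω, ((∑ i, ∑ j, X n ω i j) / ((n : ℝ) * √n)) ^ 2 ≤ K * a ^ 2 := by
    simp_rw [div_pow _ ((n : ℝ) * √n)]
    rw [integral_div, mul_pow, Real.sq_sqrt hnpos.le]
    have hb := hrow.R_bound
    calc _ ≤ (2 * n ^ 2 + n ^ 4 * κ) / ((n : ℝ) ^ 2 * n) := by gcongr
      _ = 2 * (1 / n) + C * β := by rw [hnκ]; field_simp
      _ ≤ 2 * a ^ 2 + C * a ^ 2 := by gcongr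
      _ ≤ K * a ^ 2 := by
        rw [hK]
        have : 0 < a ^ 2 := by positivity
        nlinarith [mul_pos hC this, mul_nonneg (sq_nonneg C) this.le]
  have cA := cheb hAmem hm hapos hA2
  have cW := cheb hWmem hm hapos hW2
  refine le_trans ?_ (show K / m ^ 2 + K / m ^ 2 ≤ δ by linarith)
  refine le_trans ?_ (add_le_add cA cW)
  refine le_trans ?_ (measureReal_union_le _ _)
  refine measureReal_mono (μ := (volume : Measure Ω)) fun ω hω => ?_
  by_contra hcon
  simp only [Set.mem_union, Set.mem_ofPred_eq, not_or, not_lt] at hcon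
  have hdet := det_bound (l := lam n) (Q := ∑ i, (∑ j, X n ω i j) ^ 2)
    (R := ∑ i, ∑ j, X n ω i j) hnpos hlam₀ hlam' hapos hm
    (hsmall.le.trans (min_le_left _ _)) (hsmall.le.trans (min_le_right _ _)) hcon.1 hcon.2
  have e1 : ∀ i, ∑ j, (X n ω + (lam n / √n) • onesMat n) i j =
      (∑ j, X n ω i j) + lam n / √n * n := by
    intro i
    simp [onesMat, Finset.sum_add_distrib]
    ring
  have e2 : ∑ i, ((∑ j, X n ω i j) + lam n / √n * n) =
      (∑ i, ∑ j, X n ω i j) + n * (lam n / √n * n) := by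
    simp [Finset.sum_add_distrib]
  have e3 : ∑ i, ((∑ j, X n ω i j) + lam n / √n * n) ^ 2 =
      (∑ i, (∑ j, X n ω i j) ^ 2) + 2 * (lam n / √n * n) * (∑ i, ∑ j, X n ω i j)
        + n * (lam n / √n * n) ^ 2 := by
    simp_rw [add_sq, Finset.sum_add_distrib, Finset.mul_sum]
    simp only [Finset.sum_const, Finset.card_univ, Fintype.card_fin, nsmul_eq_mul]
    congr 2
    refine Finset.sum_congr rfl fun i _ => ?_
    rw [Finset.sum_mul]
    refine Finset.sum_congr rfl fun j _ => ?_
    ring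
  have hω' : 2 * m * (2 + 1 / lam₀) * a < _ := hω
  simp only [e1] at hω'
  rw [e2, e3] at hω'
  exact absurd hω' (not_lt.2 hdet)
end
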